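/- arXiv:1303.4091 — 3 statements merged into one kernel-verified Lean document; each statement's English description precedes it below -/
import Mathlib

section
/- Let Γ be a graph satisfying the d-dimensional isoperimetric profile IS_d, and let 1 ≤ q ≤ p < d/2. Then the natural map from the reduced ℓ^q-cohomology in degree one of Γ to its reduced ℓ^p-cohomology in degree one (induced by the inclusion D^q(Γ) ⊆ D^p(Γ)) is injective: if g ∈ D^q(Γ) lies in the D^p-closure of ℓ^p(X) + ℝ·1, then g lies in the D^q-closure of ℓ^q(X) + ℝ·1. -/
open scoped BigOperators ENNReal NNReal
open Filter Topology

/-- `f` is `p`-summable (`f ∈ ℓ^p`), for a real exponent `0 < p < ∞`. -/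
def lpMem {ι : Type*} (p : ℝ) (f : ι → ℝ) : Prop := Summable fun i => |f i| ^ p

/-- The `ℓ^q`-norm with exponent `q ∈ [1,∞]`, valued in `ℝ≥0∞`. -/
noncomputable def lpENorm {ι : Type*} (q : ℝ≥0∞) (f : ι → ℝ) : ℝ≥0∞ :=
  if q = ⊤ then ⨆ i, (‖f i‖₊ : ℝ≥0∞)
  else (∑' i, (‖f i‖₊ : ℝ≥0∞) ^ q.toReal) ^ (1 / q.toReal)

/-- A bounded real-valued function. -/
def BoundedFun {ι : Type*} (f : ι → ℝ) : Prop := ∃ M : ℝ, ∀ i, |f i| ≤ M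

/-- A graph of bounded (locally finite) valency: each vertex has a finite
set of neighbours, the adjacency is symmetric and there are no loops. -/
structure LFGraph (X : Type*) where
  nbr : X → Finset X
  symm : ∀ x y : X, y ∈ nbr x ↔ x ∈ nbr y
  loopless : ∀ x : X, x ∉ nbr x

namespace LFGraph

variable {X : Type*}

/-- Adjacency. -/
def Adj (G : LFGraph X) (x y : X) : Prop := y ∈ G.nbr x

/-- Connectivity of the graph. -/
def Conn (G : LFGraph X) : Prop := ∀ x y : X, Relation.ReflTransGen G.Adj x y

/-- The valency is bounded by `D`. -/
def BddVal (G : LFGraph X) (D : ℕ) : Prop := ∀ x : X, (G.nbr x).card ≤ D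

/-- The set of oriented edges. -/
abbrev Edge (G : LFGraph X) : Type _ := {e : X × X // e.2 ∈ G.nbr e.1}

/-- The gradient `∇g(x,y) = g(y) - g(x)` of a function on the vertices,
as a function on oriented edges. -/
def grad (G : LFGraph X) (g : X → ℝ) (e : G.Edge) : ℝ := g e.1.2 - g e.1.1

/-- `g ∈ D^p(Γ)`: the gradient of `g` is in `ℓ^p(E)` (`p` finite). -/
def MemDp (G : LFGraph X) (p : ℝ) (g : X → ℝ) : Prop := lpMem p (G.grad g)

/-- The `ℓ^p(E)`-norm of the gradient of `g`. -/
noncomputable def gradNorm (G : LFGraph X) (p : ℝ) (g : X → ℝ) : ℝ :=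
  (∑' e : G.Edge, |G.grad g e| ^ p) ^ (1 / p)

/-- The `D^p`-distance between `g` and `h`, with basepoint `e0`:
`‖∇(g-h)‖_{ℓ^p(E)} + |g(e0) - h(e0)|`. -/
noncomputable def dpDist (G : LFGraph X) (p : ℝ) (e0 : X) (g h : X → ℝ) : ℝ :=
  G.gradNorm p (fun x => g x - h x) + |g e0 - h e0|

/-- `g` belongs to the `D^p`-closure of `ℓ^p(X) + ℝ·1`, i.e. the class of `g`
in the degree one reduced `ℓ^p`-cohomology is trivial. -/
def InClos (G : LFGraph X) (p : ℝ) (e0 : X) (g : X → ℝ) : Prop :=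
  ∀ ε : ℝ, 0 < ε → ∃ (f : X → ℝ) (c : ℝ), lpMem p f ∧
    G.MemDp p (fun x => g x - (f x + c)) ∧
    G.dpDist p e0 g (fun x => f x + c) < ε

/-- `g` belongs to the `D^p`-closure of `ℓ^p(X)` (no constants). -/
def InClosLp (G : LFGraph X) (p : ℝ) (e0 : X) (g : X → ℝ) : Prop :=
  ∀ ε : ℝ, 0 < ε → ∃ f : X → ℝ, lpMem p f ∧
    G.MemDp p (fun x => g x - f x) ∧
    G.dpDist p e0 g f < ε

open Classical in
/-- The number of (oriented) boundary edges of a finite set `A` of vertices. -/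
noncomputable def bdry (G : LFGraph X) (A : Finset X) : ℕ :=
  ∑ x ∈ A, ((G.nbr x).filter fun y => y ∉ A).card

/-- The `d`-dimensional isoperimetric profile `IS_d`. -/
def ISdim (G : LFGraph X) (d : ℝ) : Prop :=
  ∃ κ : ℝ, 0 < κ ∧ ∀ A : Finset X, A.Nonempty →
    (A.card : ℝ) ^ (1 - 1 / d) ≤ κ * (G.bdry A : ℝ)

/-- The strong isoperimetric profile `IS_ω`. -/
def ISomega (G : LFGraph X) : Prop :=
  ∃ κ : ℝ, 0 < κ ∧ ∀ A : Finset X, A.Nonempty →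
    (A.card : ℝ) ≤ κ * (G.bdry A : ℝ)

/-- `h` is harmonic: at every vertex, the average of `h` over the
neighbours equals the value of `h`. -/
def Harmonic (G : LFGraph X) (h : X → ℝ) : Prop :=
  ∀ x : X, ∑ y ∈ G.nbr x, h y = ((G.nbr x).card : ℝ) * h x

/-- The graph is Liouville: every bounded harmonic function is constant. -/
def Liouville (G : LFGraph X) : Prop :=
  ∀ h : X → ℝ, G.Harmonic h → BoundedFun h → ∀ x y : X, h x = h y

open Classical in
/-- `walk G n x y` is the probability `P^{(n)}_x(y)` that the simple random
walk started at `x` is at `y` at time `n`. -/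
noncomputable def walk (G : LFGraph X) : ℕ → X → X → ℝ
  | 0, x, y => if y = x then 1 else 0
  | n + 1, x, y => (∑ z ∈ G.nbr x, walk G n z y) / ((G.nbr x).card : ℝ)

/-- `avg G n g x = ∑_y P^{(n)}_x(y) g(y)`, the expected value of `g` after `n`
steps of the simple random walk started at `x`. -/
noncomputable def avg (G : LFGraph X) (n : ℕ) (g : X → ℝ) (x : X) : ℝ :=
  ∑' y, G.walk n x y * g y

/-- The Markov operator of the simple random walk: average over the neighbours. -/
noncomputable def pAvg (G : LFGraph X) (f : X → ℝ) (x : X) : ℝ :=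
  (∑ y ∈ G.nbr x, f y) / ((G.nbr x).card : ℝ)

/-- Reachability in exactly `n` steps. -/
def reachN (G : LFGraph X) : ℕ → X → X → Prop
  | 0, x, y => y = x
  | n + 1, x, y => ∃ z ∈ G.nbr x, reachN G n z y

/-- The graph distance (the smallest `n` such that `y` is reachable from `x`
in `n` steps). -/
noncomputable def gdist (G : LFGraph X) (x y : X) : ℕ :=
  sInf {n : ℕ | G.reachN n x y}

/-- `f` is a quasi-isometry between the connected graphs `G` and `H`. -/
def QI {X Y : Type*} (G : LFGraph X) (H : LFGraph Y) (f : X → Y) : Prop :=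
  G.Conn ∧ H.Conn ∧ ∃ Λ C : ℝ, 1 ≤ Λ ∧ 0 ≤ C ∧
    (∀ x x' : X, (H.gdist (f x) (f x') : ℝ) ≤ Λ * (G.gdist x x') + C) ∧
    (∀ x x' : X, (G.gdist x x' : ℝ) ≤ Λ * (H.gdist (f x) (f x')) + C) ∧
    ∀ y : Y, ∃ x : X, (H.gdist (f x) y : ℝ) ≤ C

/-- Reachability avoiding the finite set `F`. -/
def reachAvoid (G : LFGraph X) (F : Finset X) : X → X → Prop :=
  Relation.ReflTransGen fun a b => b ∈ G.nbr a ∧ a ∉ F ∧ b ∉ F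

/-- The graph has at most one end: for every finite set `F` of vertices,
the complement of `F` has at most one infinite connected component. -/
def AtMostOneEnd (G : LFGraph X) : Prop :=
  ∀ F : Finset X, ∀ x y : X, x ∉ F → y ∉ F →
    {z | G.reachAvoid F x z}.Infinite → {z | G.reachAvoid F y z}.Infinite →
    G.reachAvoid F x y

end LFGraph

/-- The Cayley graph of a group with respect to a finite symmetric generating
set `S` not containing the identity: the neighbours of `x` are the `s * x`, `s ∈ S`. -/
def cayley {Γ : Type*} [Group Γ] [DecidableEq Γ] (S : Finset Γ)
    (hsym : ∀ s ∈ S, s⁻¹ ∈ S) (h1 : (1 : Γ) ∉ S) : LFGraph Γ where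
  nbr x := S.image fun s => s * x
  symm := by
    intro x y
    simp only [Finset.mem_image]
    constructor
    · rintro ⟨s, hs, rfl⟩
      exact ⟨s⁻¹, hsym s hs, by group⟩
    · rintro ⟨s, hs, rfl⟩
      exact ⟨s⁻¹, hsym s hs, by group⟩
  loopless := by
    intro x hx
    rw [Finset.mem_image] at hx
    obtain ⟨s, hs, hsx⟩ := hx
    have hs1 : s = 1 := by
      have h' : s * x = 1 * x := by rw [one_mul]; exact hsx
      exact mul_right_cancel h'
    exact h1 (hs1 ▸ hs)

/-- The ball of radius `n` in the word metric given by `S`. -/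
def cball {Γ : Type*} [Group Γ] [DecidableEq Γ] (S : Finset Γ) : ℕ → Finset Γ
  | 0 => {1}
  | n + 1 => cball S n ∪ (cball S n).biUnion fun x => S.image fun s => s * x

/-- Amenability of a group, via the Følner condition. -/
def Amenable (Γ : Type*) [Group Γ] [DecidableEq Γ] : Prop :=
  ∀ (T : Finset Γ) (ε : ℝ), 0 < ε → ∃ F : Finset Γ, F.Nonempty ∧
    ∀ t ∈ T, (((F.image fun x => t * x) \ F).card : ℝ) ≤ ε * (F.card : ℝ)
lemma abs_sub_rpow_le {p : ℝ} (hp : 0 ≤ p) (a b : ℝ) :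
    |a - b| ^ p ≤ 2 ^ p * (|a| ^ p + |b| ^ p) := by
  have ha : 0 ≤ |a| ^ p := by positivity
  have hb : 0 ≤ |b| ^ p := by positivity
  have key : |a - b| ^ p ≤ (2 * max |a| |b|) ^ p := by
    refine Real.rpow_le_rpow (abs_nonneg _) ?_ hp
    linarith [abs_sub a b, le_max_left |a| |b|, le_max_right |a| |b|]
  rw [Real.mul_rpow (by norm_num) (by positivity)] at key
  refine key.trans (mul_le_mul_of_nonneg_left ?_ (by positivity))
  rcases max_choice |a| |b| with h | h <;> rw [h] <;> linarith

lemma lpMem.sub {ι : Type*} {p : ℝ} (hp : 0 ≤ p) {f g : ι → ℝ} (hf : lpMem p f)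
    (hg : lpMem p g) : lpMem p fun i => f i - g i :=
  .of_nonneg_of_le (fun _ => by positivity) (fun _ => abs_sub_rpow_le hp _ _)
    ((hf.add hg).mul_left _)

lemma lpMem.mono {ι : Type*} {p : ℝ} (hp : 0 ≤ p) {f g : ι → ℝ} (hf : lpMem p f)
    (h : ∀ i, |g i| ≤ |f i|) : lpMem p g :=
  .of_nonneg_of_le (fun _ => by positivity)
    (fun i => Real.rpow_le_rpow (abs_nonneg _) (h i) hp) hf

lemma lpMem.finite_superlevel {ι : Type*} {p : ℝ} (hp : 0 < p) {f : ι → ℝ} (hf : lpMem p f)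
    {t : ℝ} (ht : 0 < t) : {i | t < |f i|}.Finite := by
  have h := hf.tendsto_cofinite_zero.eventually_lt_const (Real.rpow_pos_of_pos ht p)
  rw [eventually_cofinite] at h
  exact h.subset fun i hi => not_lt.2 (Real.rpow_le_rpow ht.le (le_of_lt hi) hp.le)

namespace LFGraph

variable {X : Type*}

/-- The `p`-energy of `f`, i.e. the `p`-th power of the `ℓ^p(E)`-norm of its gradient. -/
noncomputable def energy (G : LFGraph X) (p : ℝ) (f : X → ℝ) : ℝ :=
  ∑' e : G.Edge, |G.grad f e| ^ p

lemma energy_nonneg (G : LFGraph X) (p : ℝ) (f : X → ℝ) : 0 ≤ G.energy p f :=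
  tsum_nonneg fun _ => by positivity

lemma gradNorm_lt_iff (G : LFGraph X) {p : ℝ} (hp : 0 < p) (f : X → ℝ) {ε : ℝ} (hε : 0 < ε) :
    G.gradNorm p f < ε ↔ G.energy p f < ε ^ p := by
  rw [gradNorm, one_div]
  exact Real.rpow_inv_lt_iff_of_pos (G.energy_nonneg p f) hε.le hp

open Classical in
/-- Integrating the boundary sizes of the superlevel sets of `h` between the levels `t` and `s`
gives at most the total variation of `h` on `{h > t}`. -/
lemma coarea (G : LFGraph X) {α κ : ℝ} (hα : 0 ≤ α)
    (hIS : ∀ A : Finset X, A.Nonempty → (A.card : ℝ) ^ α ≤ κ * (G.bdry A : ℝ)) (hκ : 0 < κ)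
    (h : X → ℝ) {s t : ℝ} (hts : t ≤ s) (A B : Finset X)
    (hA : ∀ x, x ∈ A ↔ t < h x) (hB : ∀ x, x ∈ B ↔ s < h x) (hne : B.Nonempty) :
    (s - t) * (B.card : ℝ) ^ α ≤ κ * ∑ x ∈ A, ∑ y ∈ G.nbr x, |h y - h x| := by
  let F : X → X → ℝ → ℝ := fun x y => (Set.Ico (h y) (h x)).indicator 1
  have hFi : ∀ x y, MeasureTheory.Integrable (F x y) := fun x y =>
    (MeasureTheory.integrable_indicator_iff measurableSet_Ico).2
      (MeasureTheory.integrableOn_const (by simp))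
  have hFle : ∀ x y, ∫ r in t..s, F x y r ≤ |h y - h x| := by
    intro x y
    rw [intervalIntegral.integral_of_le hts]
    calc ∫ r in Set.Ioc t s, F x y r ≤ ∫ r, F x y r :=
          MeasureTheory.setIntegral_le_integral (hFi x y)
            (Eventually.of_forall fun r => Set.indicator_nonneg (fun _ _ => zero_le_one) r)
      _ ≤ |h y - h x| := by
          rw [MeasureTheory.integral_indicator_one measurableSet_Ico]
          simp only [Real.volume_real_Ico]
          exact max_le (by rw [abs_sub_comm]; exact le_abs_self _) (abs_nonneg _)
  have hpt : ∀ r ∈ Set.Icc t s, (B.card : ℝ) ^ α ≤ κ * ∑ x ∈ A, ∑ y ∈ G.nbr x, F x y r := by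
    intro r hr
    have hsub : B ⊆ A.filter (r < h ·) := fun x hx => by
      rw [hB] at hx
      simp only [Finset.mem_filter, hA]
      exact ⟨by linarith [hr.1, hr.2], by linarith [hr.2]⟩
    refine (Real.rpow_le_rpow (by positivity)
      (Nat.cast_le.2 (Finset.card_le_card hsub)) hα).trans ((hIS _ (hne.mono hsub)).trans ?_)
    refine mul_le_mul_of_nonneg_left (le_of_eq ?_) hκ.le
    rw [bdry, Nat.cast_sum, Finset.sum_filter]
    refine Finset.sum_congr rfl fun x hx => ?_
    split_ifs with hrx
    · rw [Finset.card_filter, Nat.cast_sum]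
      refine Finset.sum_congr rfl fun y _ => ?_
      have : y ∉ A.filter (r < h ·) ↔ r ∈ Set.Ico (h y) (h x) := by
        simp only [Finset.mem_filter, hA, Set.mem_Ico, not_and, not_lt]
        exact ⟨fun H => ⟨by by_contra! H'; linarith [H (by linarith [hr.1])], hrx⟩,
          fun H _ => H.1⟩
      by_cases hy : r ∈ Set.Ico (h y) (h x)
      · simp only [F, Set.indicator_of_mem hy, if_pos (this.2 hy)]; simp
      · simp only [F, Set.indicator_of_notMem hy, if_neg (mt this.1 hy)]; simp
    · refine (Finset.sum_eq_zero fun y _ => Set.indicator_of_notMem ?_ _).symm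
      exact fun H => hrx H.2
  have hint : ∀ x, IntervalIntegrable (fun r => ∑ y ∈ G.nbr x, F x y r)
      MeasureTheory.volume t s := fun x =>
    (MeasureTheory.integrable_finsetSum _ fun y _ => hFi x y).intervalIntegrable
  have hint' : IntervalIntegrable (fun r => ∑ x ∈ A, ∑ y ∈ G.nbr x, F x y r)
      MeasureTheory.volume t s :=
    (MeasureTheory.integrable_finsetSum _ fun x _ =>
      MeasureTheory.integrable_finsetSum _ fun y _ => hFi x y).intervalIntegrable
  have := intervalIntegral.integral_mono_on hts intervalIntegrable_const
    (hint'.const_mul κ) hpt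
  rw [intervalIntegral.integral_const, smul_eq_mul, intervalIntegral.integral_const_mul,
    intervalIntegral.integral_finsetSum fun x _ => hint x] at this
  refine this.trans (mul_le_mul_of_nonneg_left (Finset.sum_le_sum fun x _ => ?_) hκ.le)
  rw [intervalIntegral.integral_finsetSum fun y _ => (hFi x y).intervalIntegrable]
  exact Finset.sum_le_sum fun y _ => hFle x y

/-- The total variation of `f` on a finite set is controlled by its `p`-energy. -/
lemma sum_grad_rpow_le (G : LFGraph X) {D : ℕ} (hval : G.BddVal D) {p : ℝ} (hp : 1 ≤ p)
    {f : X → ℝ} (hf : G.MemDp p f) (A : Finset X) :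
    (∑ x ∈ A, ∑ y ∈ G.nbr x, |f y - f x|) ^ p ≤
      ((D : ℝ) * A.card) ^ (p - 1) * G.energy p f := by
  have hcard : ((A.sigma G.nbr).card : ℝ) ≤ D * A.card := by
    rw [Finset.card_sigma, mul_comm]
    exact_mod_cast Finset.sum_le_card_nsmul A _ D fun x _ => hval x
  rw [← Finset.sum_sigma A G.nbr fun z => |f z.2 - f z.1|]
  refine (Real.rpow_sum_le_const_mul_sum_rpow _ _ hp).trans (mul_le_mul
    (Real.rpow_le_rpow (by positivity) hcard (by linarith)) ?_
    (Finset.sum_nonneg fun _ _ => by positivity) (by positivity))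
  let i : A.sigma G.nbr → G.Edge := fun z => ⟨(z.1.1, z.1.2), (Finset.mem_sigma.1 z.2).2⟩
  have hi : Function.Injective i := by
    rintro ⟨⟨a, b⟩, hz⟩ ⟨⟨a', b'⟩, hz'⟩ h
    simp only [i, Subtype.mk.injEq, Prod.mk.injEq] at h
    obtain ⟨rfl, rfl⟩ := h
    rfl
  rw [← Finset.sum_coe_sort, ← tsum_fintype (L := .unconditional _)]
  exact tsum_comp_le_tsum_of_inj hf (fun _ => by positivity) hi

/-- If `ν (k+1) ^ (p-1) ≥ K ^ p * 2 ^ (-p k) * ν k ^ a` at each step, with `K` large enough,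
then `ν` grows at least exponentially. -/
lemma pow_le_of_growth {K p a : ℝ} (hp : 1 ≤ p) (hK : 1 < K) (hK' : 2 ^ p ≤ K ^ (a - (p - 1)))
    (ha : 0 ≤ a) {ν : ℕ → ℝ} (h0 : 1 ≤ ν 0) (hν : ∀ k, 0 ≤ ν k)
    (h : ∀ k, K ^ p * ν k ^ a ≤ ((2 : ℝ) ^ p) ^ k * ν (k + 1) ^ (p - 1)) (k : ℕ) :
    K ^ k ≤ ν k := by
  have hK0 : 0 < K := by linarith
  induction k with
  | zero => simpa using h0
  | succ k ih =>
    by_contra! hlt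
    have h1 : ν (k + 1) ^ (p - 1) ≤ (K ^ (k + 1)) ^ (p - 1) :=
      Real.rpow_le_rpow (hν _) hlt.le (by linarith)
    have h2 : (K ^ k) ^ a ≤ ν k ^ a := Real.rpow_le_rpow (by positivity) ih ha
    have h3 : ((2 : ℝ) ^ p) ^ k ≤ (K ^ (a - (p - 1))) ^ k :=
      pow_le_pow_left₀ (by positivity) hK' k
    have h4 : K ^ p * (K ^ k) ^ a ≤ (K ^ (a - (p - 1))) ^ k * (K ^ (k + 1)) ^ (p - 1) :=
      calc _ ≤ K ^ p * ν k ^ a := by gcongr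
        _ ≤ _ := h k
        _ ≤ _ := mul_le_mul h3 h1 (Real.rpow_nonneg (hν _) _) (by positivity)
    simp only [← Real.rpow_natCast, ← Real.rpow_mul hK0.le, ← Real.rpow_add hK0] at h4
    rw [Real.rpow_le_rpow_left_iff hK] at h4
    push_cast at h4
    nlinarith

open Classical in
/-- Under `IS_d` and for `p < d`, functions in `ℓ^p` satisfy a sup-norm Sobolev inequality. -/
lemma exists_sup_le_energy (G : LFGraph X) {D : ℕ} (hval : G.BddVal D) {d p : ℝ}
    (hIS : G.ISdim d) (hp : 1 ≤ p) (hpd : p < d) :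
    ∃ C : ℝ, 0 ≤ C ∧ ∀ f : X → ℝ, lpMem p f → G.MemDp p f → ∀ x,
      |f x| ^ p ≤ C * G.energy p f := by
  obtain ⟨κ, hκ, hIS⟩ := hIS
  have hd : 0 < d := by linarith
  have hp0 : 0 < p := by linarith
  set α : ℝ := 1 - 1 / d with hαdef
  have hα : 0 ≤ α := by
    rw [hαdef, sub_nonneg, div_le_one hd]; linarith
  have hθ : 0 < α * p - (p - 1) := by
    have : p / d < 1 := (div_lt_one hd).2 hpd
    have e : α * p - (p - 1) = 1 - p / d := by rw [hαdef]; ring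
    linarith
  obtain ⟨K, hKp, hK1, hKθ⟩ : ∃ K : ℝ, 2 ^ p < K ∧ 1 < K ∧ 2 ^ p ≤ K ^ (α * p - (p - 1)) :=
    ((eventually_gt_atTop _).and ((eventually_gt_atTop _).and
      ((tendsto_rpow_atTop hθ).eventually_ge_atTop _))).exists
  set Q : ℝ := κ ^ p * (D : ℝ) ^ (p - 1) with hQ
  have hQ0 : 0 ≤ Q := by positivity
  refine ⟨Q * 4 ^ p * K ^ p, by positivity, fun f hf hfD x₀ => ?_⟩
  by_contra! hlt
  set P := G.energy p f with hP
  have hP0 : 0 ≤ P := G.energy_nonneg p f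
  set M := |f x₀| with hM
  have hMp : 0 < M ^ p := lt_of_le_of_lt (by positivity) hlt
  have hM0 : 0 < M := by
    refine lt_of_le_of_ne (abs_nonneg _) fun h => ?_
    rw [← h, Real.zero_rpow hp0.ne'] at hMp
    exact lt_irrefl _ hMp
  have hs : ∀ k : ℕ, 0 < M / 2 ^ (k + 1) := fun k => by positivity
  let A : ℕ → Finset X := fun k => (hf.finite_superlevel hp0 (hs k)).toFinset
  have hA : ∀ k x, x ∈ A k ↔ M / 2 ^ (k + 1) < |f x| := fun k x => by simp [A]
  have hx₀ : ∀ k, x₀ ∈ A k := fun k => by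
    rw [hA]
    exact div_lt_self hM0 (one_lt_pow₀ (by norm_num) (by omega))
  have habs : ∀ x y, |(|f y| - |f x|)| ≤ |f y - f x| := fun x y => abs_abs_sub_abs_le _ _
  have hstep : ∀ k, M ^ p * ((A k).card : ℝ) ^ (α * p) ≤
      Q * P * 4 ^ p * (((2 : ℝ) ^ p) ^ k * ((A (k + 1)).card : ℝ) ^ (p - 1)) := by
    intro k
    have h1 := G.coarea hα hIS hκ (fun x => |f x|) (s := M / 2 ^ (k + 1))
      (t := M / 2 ^ (k + 1 + 1))
      (div_le_div_of_nonneg_left hM0.le (by positivity)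
        (pow_le_pow_right₀ (by norm_num) (by omega)))
      (A (k + 1)) (A k) (hA (k + 1)) (hA k) ⟨x₀, hx₀ k⟩
    have h2 : M / (4 * 2 ^ k) * ((A k).card : ℝ) ^ α ≤
        κ * ∑ x ∈ A (k + 1), ∑ y ∈ G.nbr x, |f y - f x| := by
      have e : M / 2 ^ (k + 1) - M / 2 ^ (k + 1 + 1) = M / (4 * 2 ^ k) := by
        field_simp; ring
      rw [e] at h1
      refine h1.trans (mul_le_mul_of_nonneg_left ?_ hκ.le)
      exact Finset.sum_le_sum fun x _ => Finset.sum_le_sum fun y _ => habs x y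
    have h3 := Real.rpow_le_rpow (by positivity) h2 hp0.le
    rw [Real.mul_rpow (by positivity) (by positivity), Real.mul_rpow hκ.le
      (Finset.sum_nonneg fun _ _ => Finset.sum_nonneg fun _ _ => abs_nonneg _),
      Real.div_rpow hM0.le (by positivity), Real.mul_rpow (by norm_num) (by positivity),
      ← Real.rpow_mul (by positivity)] at h3
    have h4 := h3.trans (mul_le_mul_of_nonneg_left
      (G.sum_grad_rpow_le hval hp hfD (A (k + 1))) (by positivity))
    rw [Real.mul_rpow (by positivity) (by positivity), ← Real.rpow_natCast, ← Real.rpow_mul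
      (by norm_num), mul_comm (k : ℝ) p, Real.rpow_mul (by norm_num), Real.rpow_natCast,
      div_mul_eq_mul_div, div_le_iff₀ (by positivity)] at h4
    exact h4.trans (le_of_eq (by rw [hQ]; ring))
  have hcard : ∀ k, (1 : ℝ) ≤ (A k).card := fun k => by
    exact_mod_cast Finset.card_pos.2 ⟨x₀, hx₀ k⟩
  have hQP : 0 < Q * P := by
    refine lt_of_le_of_ne (by positivity) fun h => ?_
    have := hstep 0
    rw [← h] at this
    have h' : 0 < M ^ p * ((A 0).card : ℝ) ^ (α * p) :=
      mul_pos hMp (Real.rpow_pos_of_pos (by linarith [hcard 0]) _)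
    linarith
  have hgrow := pow_le_of_growth hp hK1 hKθ (by positivity)
    (ν := fun k => ((A k).card : ℝ)) (hcard 0) (fun k => by positivity) fun k => by
      have h5 : Q * 4 ^ p * K ^ p * P * ((A k).card : ℝ) ^ (α * p) ≤
          M ^ p * ((A k).card : ℝ) ^ (α * p) := by gcongr
      have h6 := h5.trans (hstep k)
      refine le_of_mul_le_mul_left ?_ (by positivity : 0 < Q * P * 4 ^ p)
      linarith
  have hupper : ∀ k, (M / 2) ^ p * (K / 2 ^ p) ^ k ≤ ∑' x, |f x| ^ p := by
    intro k
    calc (M / 2) ^ p * (K / 2 ^ p) ^ k = (M / 2 ^ (k + 1)) ^ p * K ^ k := by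
          rw [pow_succ, mul_comm ((2 : ℝ) ^ k), ← div_div, Real.div_rpow (x := M / 2)
            (by positivity) (by positivity), ← Real.rpow_natCast (2 : ℝ), ← Real.rpow_mul
            (by norm_num), mul_comm (k : ℝ) p, Real.rpow_mul (by norm_num), Real.rpow_natCast,
            div_pow]
          ring
      _ ≤ (M / 2 ^ (k + 1)) ^ p * (A k).card := by gcongr; exact hgrow k
      _ = ∑ x ∈ A k, (M / 2 ^ (k + 1)) ^ p := by
          rw [Finset.sum_const, nsmul_eq_mul, mul_comm]
      _ ≤ ∑ x ∈ A k, |f x| ^ p := Finset.sum_le_sum fun x hx =>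
          Real.rpow_le_rpow (hs k).le ((hA k x).1 hx).le hp0.le
      _ ≤ ∑' x, |f x| ^ p := hf.sum_le_tsum _ fun _ _ => by positivity
  have htop : Tendsto (fun k : ℕ => (M / 2) ^ p * (K / 2 ^ p) ^ k) atTop atTop :=
    (tendsto_pow_atTop_atTop_of_one_lt ((one_lt_div (by positivity)).2 hKp)).const_mul_atTop
      (by positivity)
  obtain ⟨k, hk⟩ := (htop.eventually_gt_atTop (∑' x, |f x| ^ p)).exists
  exact absurd (hupper k) (not_le.2 hk)

lemma grad_rpow_le_energy (G : LFGraph X) {p : ℝ} {f : X → ℝ} (hf : G.MemDp p f)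
    (e : G.Edge) : |G.grad f e| ^ p ≤ G.energy p f :=
  hf.le_tsum e fun _ _ => by positivity

lemma energy_sub_le (G : LFGraph X) {p : ℝ} (hp : 0 ≤ p) {f h k : X → ℝ}
    (hh : G.MemDp p h) (hk : G.MemDp p k) (hf : ∀ e, G.grad f e = G.grad h e - G.grad k e) :
    G.MemDp p f ∧ G.energy p f ≤ 2 ^ p * (G.energy p h + G.energy p k) := by
  have hmem : G.MemDp p f := by
    rw [MemDp, funext hf]
    exact lpMem.sub hp hh hk
  refine ⟨hmem, ?_⟩
  unfold energy
  rw [← Summable.tsum_add hh hk, ← tsum_mul_left]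
  refine hmem.tsum_le_tsum (fun e => ?_) ((hh.add hk).mul_left _)
  rw [hf]
  exact abs_sub_rpow_le hp _ _

/-- On a connected graph, convergence at a basepoint and of the energies to `0` gives
pointwise convergence to `0`. -/
lemma tendsto_zero_of_energy (G : LFGraph X) (hconn : G.Conn) {p : ℝ} (hp : 0 < p) {e0 : X}
    {h : ℕ → X → ℝ} (hmem : ∀ n, G.MemDp p (h n))
    (hE : Tendsto (fun n => G.energy p (h n)) atTop (𝓝 0))
    (h0 : Tendsto (fun n => h n e0) atTop (𝓝 0)) (x : X) :
    Tendsto (fun n => h n x) atTop (𝓝 0) := by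
  induction hconn e0 x with
  | refl => exact h0
  | @tail y z _ hyz ih =>
    have h1 : Tendsto (fun n => |h n z - h n y|) atTop (𝓝 0) := by
      refine squeeze_zero (fun _ => abs_nonneg _) (fun n => ?_)
        (by simpa [hp.ne'] using hE.rpow_const (p := p⁻¹) (Or.inr (by positivity)))
      rw [Real.le_rpow_inv_iff_of_pos (abs_nonneg _) (G.energy_nonneg _ _) hp]
      exact G.grad_rpow_le_energy (hmem n) ⟨(y, z), hyz⟩
    simpa using ((tendsto_zero_iff_abs_tendsto_zero _).2 h1).add ih

/-- Under `IS_d` and for `p < d`, functions in the `D^p`-closure of `ℓ^p(X) + ℝ·1` tend to a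
constant at infinity. -/
lemma InClos.exists_finite_superlevel {G : LFGraph X} (hconn : G.Conn) {D : ℕ}
    (hval : G.BddVal D) {d p : ℝ} (hIS : G.ISdim d) (hp : 1 ≤ p) (hpd : p < d) {e0 : X}
    {g : X → ℝ} (hg : G.InClos p e0 g) :
    ∃ c : ℝ, ∀ t : ℝ, 0 < t → {x | t < |g x - c|}.Finite := by
  have hp0 : 0 < p := by linarith
  obtain ⟨C, hC, hsup⟩ := G.exists_sup_le_energy hval hIS hp hpd
  choose f c hf hmem hdist using fun n : ℕ => hg (1 / ((n : ℝ) + 1)) (by positivity)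
  let h : ℕ → X → ℝ := fun n x => g x - (f n x + c n)
  have hgn : ∀ n, 0 ≤ G.gradNorm p (h n) := fun n =>
    Real.rpow_nonneg (G.energy_nonneg p (h n)) _
  have hE : Tendsto (fun n => G.energy p (h n)) atTop (𝓝 0) := by
    have h1 : Tendsto (fun n : ℕ => (1 / ((n : ℝ) + 1)) ^ p) atTop (𝓝 0) := by
      simpa [hp0.ne'] using (tendsto_one_div_add_atTop_nhds_zero_nat (𝕜 := ℝ)).rpow_const
        (p := p) (Or.inr hp0.le)
    refine squeeze_zero (fun n => G.energy_nonneg _ _) (fun n => ?_) h1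
    refine ((G.gradNorm_lt_iff hp0 (h n) (by positivity)).1 ?_).le
    have := hdist n
    rw [dpDist] at this
    exact lt_of_le_of_lt (le_add_of_nonneg_right (abs_nonneg _)) this
  have h0 : Tendsto (fun n => h n e0) atTop (𝓝 0) := by
    refine (tendsto_zero_iff_abs_tendsto_zero _).2 (squeeze_zero (fun _ => abs_nonneg _)
      (fun n => ?_) (tendsto_one_div_add_atTop_nhds_zero_nat (𝕜 := ℝ)))
    exact (le_add_of_nonneg_left (hgn n)).trans (hdist n).le
  have hpt := G.tendsto_zero_of_energy hconn hp0 hmem hE h0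
  have hpair : ∀ m n x, |f m x - f n x| ^ p ≤
      C * (2 ^ p * (G.energy p (h n) + G.energy p (h m))) := by
    intro m n x
    obtain ⟨h1, h2⟩ := G.energy_sub_le hp0.le (f := fun x => f m x - f n x) (hmem n) (hmem m)
      fun e => by simp only [grad]; ring
    exact (hsup _ (lpMem.sub hp0.le (hf m) (hf n)) h1 x).trans (mul_le_mul_of_nonneg_left h2 hC)
  have hunif : ∀ ε > 0, ∃ N, ∀ m ≥ N, ∀ n ≥ N, ∀ x, |f m x - f n x| < ε := by
    intro ε hε
    have hlim : Tendsto (fun n => C * (2 ^ p * (2 * G.energy p (h n)))) atTop (𝓝 0) := by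
      simpa using ((hE.const_mul 2).const_mul (2 ^ p)).const_mul C
    obtain ⟨N, hN⟩ := eventually_atTop.1
      (hlim.eventually_lt_const (Real.rpow_pos_of_pos hε p))
    refine ⟨N, fun m hm n hn x => ?_⟩
    rw [← Real.rpow_lt_rpow_iff (abs_nonneg _) hε.le hp0]
    refine (hpair m n x).trans_lt ?_
    linarith [hN m hm, hN n hn]
  obtain ⟨c', hc'⟩ : ∃ c', Tendsto c atTop (𝓝 c') := by
    have hf0 : CauchySeq fun n => f n e0 := Metric.cauchySeq_iff.2 fun ε hε => by
      obtain ⟨N, hN⟩ := hunif ε hε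
      exact ⟨N, fun m hm n hn => hN m hm n hn e0⟩
    obtain ⟨a, ha⟩ := cauchySeq_tendsto_of_complete hf0
    refine ⟨g e0 - 0 - a, ((tendsto_const_nhds.sub h0).sub ha).congr fun n => ?_⟩
    simp only [h]
    ring
  refine ⟨c', fun t ht => ?_⟩
  obtain ⟨N, hN⟩ := hunif (t / 2) (by positivity)
  refine ((hf N).finite_superlevel hp0 (half_pos ht)).subset fun x hx => ?_
  have hlim : Tendsto (fun m => |f m x - f N x|) atTop (𝓝 |g x - c' - f N x|) := by
    have h1 := ((((tendsto_const_nhds (x := g x)).sub hc').sub (hpt x)).sub_const (f N x)).abs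
    rw [sub_zero] at h1
    refine h1.congr fun m => ?_
    change |g x - c m - (g x - (f m x + c m)) - f N x| = _
    congr 1
    ring
  have hle : |g x - c' - f N x| ≤ t / 2 :=
    le_of_tendsto hlim (eventually_atTop.2 ⟨N, fun m hm => (hN m hm N le_rfl x).le⟩)
  have htri := abs_sub_abs_le_abs_sub (g x - c') (f N x)
  simp only [Set.mem_ofPred_eq] at hx ⊢
  linarith

/-- A function with `ℓ^q` gradient tending to a constant at infinity is a `D^q`-limit of
finitely supported functions plus that constant. -/
lemma inClos_of_finite_superlevel (G : LFGraph X) {q : ℝ} (hq : 0 < q) (e0 : X) {g : X → ℝ}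
    (hg : G.MemDp q g) {c : ℝ} (hfin : ∀ t : ℝ, 0 < t → {x | t < |g x - c|}.Finite) :
    G.InClos q e0 g := by
  intro ε hε
  let φ : ℝ → X → ℝ := fun t x => max (-t) (min t (g x - c))
  have hφ_lip : ∀ t e, |G.grad (φ t) e| ≤ |G.grad g e| := by
    intro t e
    simp only [grad, φ]
    refine (abs_max_sub_max_le_max _ _ _ _).trans ?_
    rw [sub_self, abs_zero]
    refine max_le (abs_nonneg _) ((abs_min_sub_min_le_max _ _ _ _).trans ?_)
    rw [sub_self, abs_zero]
    exact max_le (abs_nonneg _) (le_of_eq (by congr 1; ring))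
  have hφ_le : ∀ t, 0 ≤ t → ∀ x, |φ t x| ≤ t := fun t ht x =>
    abs_le.2 ⟨le_max_left _ _, max_le (by linarith) (min_le_left _ _)⟩
  have hpt : ∀ e, Tendsto (fun t => |G.grad (φ t) e| ^ q) (𝓝[>] 0) (𝓝 0) := by
    intro e
    have h1 : Tendsto (fun t : ℝ => (2 * t) ^ q) (𝓝[>] 0) (𝓝 0) := by
      have h2 : Tendsto (fun t : ℝ => 2 * t) (𝓝[>] 0) (𝓝 0) := by
        simpa using
          (tendsto_id.mono_left (nhdsWithin_le_nhds (a := (0 : ℝ)) (s := Set.Ioi 0))).const_mul 2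
      simpa [hq.ne'] using h2.rpow_const (p := q) (Or.inr hq.le)
    refine tendsto_of_tendsto_of_tendsto_of_le_of_le' tendsto_const_nhds h1
      (Eventually.of_forall fun t => by positivity) ?_
    filter_upwards [self_mem_nhdsWithin] with t ht
    have ht' : 0 ≤ t := le_of_lt ht
    refine Real.rpow_le_rpow (abs_nonneg _) ?_ hq.le
    exact (abs_sub _ _).trans (by linarith [hφ_le t ht' e.1.1, hφ_le t ht' e.1.2])
  have hE : Tendsto (fun t => G.energy q (φ t)) (𝓝[>] 0) (𝓝 0) := by
    have := tendsto_tsum_of_dominated_convergence (bound := fun e => |G.grad g e| ^ q) hg hpt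
      (Eventually.of_forall fun t e => by
        rw [Real.norm_of_nonneg (by positivity)]
        exact Real.rpow_le_rpow (abs_nonneg _) (hφ_lip t e) hq.le)
    simpa [energy] using this
  obtain ⟨t, htE, htε, ht⟩ := ((hE.eventually_lt_const (Real.rpow_pos_of_pos (half_pos hε) q)).and
    ((eventually_nhdsWithin_of_eventually_nhds (eventually_lt_nhds (half_pos hε))).and
      self_mem_nhdsWithin)).exists
  have ht0 : 0 < t := ht
  have hrest : (fun x => g x - (g x - c - φ t x + c)) = φ t := by
    funext x; ring
  refine ⟨fun x => g x - c - φ t x, c, ?_, ?_, ?_⟩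
  · refine summable_of_hasFiniteSupport ((hfin t ht0).subset fun x hx => ?_)
    by_contra hle
    simp only [Set.mem_ofPred_eq, not_lt, abs_le] at hle
    refine hx ?_
    simp [φ, hle.1, hle.2, hq.ne']
  · rw [hrest]
    exact lpMem.mono hq.le hg (hφ_lip t)
  · rw [dpDist, hrest]
    have h1 := (G.gradNorm_lt_iff hq (φ t) (half_pos hε)).2 htE
    have h2 : |g e0 - (g e0 - c - φ t e0 + c)| ≤ t := by
      rw [congrFun hrest e0]
      exact hφ_le t ht0.le e0
    linarith

end LFGraph

/-- For a graph with `IS_d` and `1 ≤ q ≤ p < d/2`, the natural map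
from reduced `ℓ^q`-cohomology to reduced `ℓ^p`-cohomology in degree one is injective. -/
theorem stmt0 {X : Type*} (G : LFGraph X) (hconn : G.Conn) (D : ℕ) (hval : G.BddVal D)
    (d q p : ℝ) (hIS : G.ISdim d) (hq : 1 ≤ q) (hqp : q ≤ p) (hpd : p < d / 2)
    (e0 : X) (g : X → ℝ) (hg : G.MemDp q g)
    (htriv : G.InClos p e0 g) : G.InClos q e0 g := by
  have hd : p < d := by linarith
  obtain ⟨c, hc⟩ := htriv.exists_finite_superlevel hconn hval hIS (hq.trans hqp) hd
  exact G.inClos_of_finite_superlevel (by linarith) e0 hg hc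
end

section
/- Let Γ be a Liouville graph satisfying the d-dimensional isoperimetric profile IS_d, and let 1 ≤ p < d/2. Then the reduced ℓ^p-cohomology of Γ in degree one is trivial: D^p(Γ) equals the D^p-closure of ℓ^p(X) + ℝ·1. -/
open scoped BigOperators ENNReal NNReal
open Filter Topology

namespace LFGraph

variable {X : Type*}

/-- Coarea argument: an isoperimetric inequality gives an `ℓ^1`-Sobolev inequality. -/
theorem sobolev_of_isoperimetric (G : LFGraph X) {α κ : ℝ} (hα : 1 ≤ α)
    (hiso : ∀ A : Finset X, A.Nonempty → (A.card : ℝ) ^ (1 / α) ≤ κ * (G.bdry A : ℝ))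
    (A : Finset X) (v : X → ℝ) (hv : ∀ x, 0 ≤ v x) (hA : ∀ x, x ∉ A → v x = 0) :
    (∑ x ∈ A, v x ^ α) ^ (1 / α) ≤ κ * ∑ x ∈ A, ∑ y ∈ G.nbr x, max (v x - v y) 0 := by
  classical
  have hα0 : 0 < α := by linarith
  induction A using Finset.strongInduction generalizing v with
  | H A ih =>
    rcases A.eq_empty_or_nonempty with rfl | hne
    · simp [Real.zero_rpow (inv_ne_zero hα0.ne')]
    obtain ⟨x₀, hx₀, hmin⟩ := A.exists_min_image v hne
    set m := v x₀ with hm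
    have hm0 : 0 ≤ m := hv x₀
    set v' : X → ℝ := fun x => if x ∈ A then v x - m else 0 with hv'
    have hv'0 : ∀ x, 0 ≤ v' x := by
      intro x
      by_cases hx : x ∈ A
      · simpa [hv', hx] using hmin x hx
      · simp [hv', hx]
    have hx₀' : v' x₀ = 0 := by simp [hv', hx₀, hm]
    have hA' : ∀ x, x ∉ A.erase x₀ → v' x = 0 := by
      intro x hx
      by_cases hxx : x = x₀
      · rw [hxx, hx₀']
      · have : x ∉ A := fun h => hx (Finset.mem_erase.2 ⟨hxx, h⟩)
        simp [hv', this]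
    have key := ih (A.erase x₀) (Finset.erase_ssubset hx₀) v' hv'0 hA'
    rw [Finset.sum_erase A (by rw [hx₀', Real.zero_rpow hα0.ne']),
      Finset.sum_erase A (Finset.sum_eq_zero fun y _ => by
        rw [hx₀']; exact max_eq_right (by linarith [hv'0 y]))] at key
    have hmink := Real.Lp_add_le A v' (fun _ => m) hα
    have h1 : ∑ x ∈ A, |v' x + m| ^ α = ∑ x ∈ A, v x ^ α :=
      Finset.sum_congr rfl fun x hx => by
        simp only [hv', hx, if_true, sub_add_cancel, abs_of_nonneg (hv x)]
    have h2 : ∑ x ∈ A, |v' x| ^ α = ∑ x ∈ A, v' x ^ α :=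
      Finset.sum_congr rfl fun x _ => by rw [abs_of_nonneg (hv'0 x)]
    have h3 : (∑ _x ∈ A, |m| ^ α) ^ (1 / α) = (A.card : ℝ) ^ (1 / α) * m := by
      rw [Finset.sum_const, nsmul_eq_mul, abs_of_nonneg hm0,
        Real.mul_rpow (Nat.cast_nonneg _) (Real.rpow_nonneg hm0 _), ← Real.rpow_mul hm0,
        mul_one_div_cancel hα0.ne', Real.rpow_one]
    have h4 : ∑ x ∈ A, ∑ y ∈ G.nbr x, max (v x - v y) 0 =
        (∑ x ∈ A, ∑ y ∈ G.nbr x, max (v' x - v' y) 0) + G.bdry A * m := by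
      have hb : (G.bdry A : ℝ) * m = ∑ x ∈ A, ∑ y ∈ G.nbr x, if y ∉ A then m else 0 := by
        rw [bdry, Nat.cast_sum, Finset.sum_mul]
        refine Finset.sum_congr rfl fun x _ => ?_
        rw [← Finset.sum_filter, Finset.sum_const, nsmul_eq_mul]
      rw [hb, ← Finset.sum_add_distrib]
      refine Finset.sum_congr rfl fun x hx => ?_
      rw [← Finset.sum_add_distrib]
      refine Finset.sum_congr rfl fun y _ => ?_
      by_cases hy : y ∈ A
      · simp [hv', hx, hy]
      · have := hmin x hx
        simp only [hv', hx, hy, if_true, if_false, hA y hy, not_false_eq_true, sub_zero]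
        rw [max_eq_left (hv x), max_eq_left (by linarith)]
        ring
    rw [h1, h2, h3] at hmink
    have h5 := mul_le_mul_of_nonneg_right (hiso A hne) hm0
    rw [h4]
    linarith

/-- Summation by parts over the edges of a graph, in the form of an inequality. -/
theorem sum_edges_nonneg (G : LFGraph X) (A : Finset X) (H : X → X → ℝ)
    (hA : ∀ x y, x ∉ A → H x y = 0) (hH : ∀ x y, 0 ≤ H x y + H y x) :
    0 ≤ ∑ x ∈ A, ∑ y ∈ G.nbr x, H x y := by
  classical
  set B := A ∪ A.biUnion G.nbr
  have h1 : ∑ x ∈ A, ∑ y ∈ G.nbr x, H x y =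
      ∑ x ∈ B, ∑ y ∈ B, if y ∈ G.nbr x then H x y else 0 := by
    rw [← Finset.sum_subset (Finset.subset_union_left : A ⊆ B)]
    · refine Finset.sum_congr rfl fun x hx => ?_
      rw [← Finset.sum_filter]
      refine Finset.sum_congr ?_ fun _ _ => rfl
      ext y
      simp only [Finset.mem_filter]
      exact ⟨fun hy => ⟨Finset.mem_union_right _ (Finset.mem_biUnion.2 ⟨x, hx, hy⟩), hy⟩,
        fun hy => hy.2⟩
    · intro x _ hx
      exact Finset.sum_eq_zero fun y _ => by simp [hA x y hx]
  have h2 : ∑ x ∈ B, ∑ y ∈ B, (if y ∈ G.nbr x then H x y else 0) =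
      ∑ x ∈ B, ∑ y ∈ B, if y ∈ G.nbr x then H y x else 0 := by
    rw [Finset.sum_comm]
    refine Finset.sum_congr rfl fun x _ => Finset.sum_congr rfl fun y _ => ?_
    simp only [G.symm x y]
  have h3 : 0 ≤ (∑ x ∈ B, ∑ y ∈ B, if y ∈ G.nbr x then H x y else 0) +
      ∑ x ∈ B, ∑ y ∈ B, if y ∈ G.nbr x then H y x else 0 := by
    rw [← Finset.sum_add_distrib]
    refine Finset.sum_nonneg fun x _ => ?_
    rw [← Finset.sum_add_distrib]
    refine Finset.sum_nonneg fun y _ => ?_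
    split_ifs
    · exact hH x y
    · simp
  rw [h1]
  linarith

theorem energy_pointwise {s : ℝ} (hs : 2 ≤ s) (a b : ℝ) :
    |a| ^ (s - 2) * max (|a| - |b|) 0 ^ 2 + |b| ^ (s - 2) * max (|b| - |a|) 0 ^ 2 ≤
      (a - b) * (|a| ^ (s - 2) * a) + (b - a) * (|b| ^ (s - 2) * b) := by
  wlog h : |b| ≤ |a| generalizing a b
  · have := this b a (le_of_not_ge h)
    linarith
  have hR : 0 ≤ |b| ^ (s - 2) := Real.rpow_nonneg (abs_nonneg _) _
  have hPR : |b| ^ (s - 2) ≤ |a| ^ (s - 2) :=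
    Real.rpow_le_rpow (abs_nonneg _) h (by linarith)
  generalize |a| ^ (s - 2) = P at *
  generalize |b| ^ (s - 2) = R at *
  rw [max_eq_left (by linarith), max_eq_right (by linarith)]
  have hab : a * b ≤ |a| * |b| := by rw [← abs_mul]; exact le_abs_self _
  have h1 := mul_le_mul_of_nonneg_left hab (by linarith : 0 ≤ P + R)
  have h2 : 0 ≤ (P - R) * (|b| * (|a| - |b|)) :=
    mul_nonneg (by linarith) (mul_nonneg (abs_nonneg _) (by linarith))
  have ha := sq_abs a
  have hb := sq_abs b
  have e1 : P * a ^ 2 = P * |a| ^ 2 := by rw [ha]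
  have e2 : R * b ^ 2 = R * |b| ^ 2 := by rw [hb]
  nlinarith

/-- The (unnormalised, positive) Laplacian. -/
def lap (G : LFGraph X) (u : X → ℝ) (x : X) : ℝ := ∑ y ∈ G.nbr x, (u x - u y)

theorem energy_le (G : LFGraph X) {s : ℝ} (hs : 2 ≤ s) (A : Finset X) (u : X → ℝ)
    (hA : ∀ x, x ∉ A → u x = 0) :
    ∑ x ∈ A, ∑ y ∈ G.nbr x, |u x| ^ (s - 2) * max (|u x| - |u y|) 0 ^ 2 ≤
      ∑ x ∈ A, G.lap u x * (|u x| ^ (s - 2) * u x) := by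
  have := G.sum_edges_nonneg A
    (fun x y => (u x - u y) * (|u x| ^ (s - 2) * u x) -
      |u x| ^ (s - 2) * max (|u x| - |u y|) 0 ^ 2)
    (fun x y hx => by simp [hA x hx])
    (fun x y => by linarith [energy_pointwise hs (u x) (u y)])
  simp only [Finset.sum_sub_distrib, ← Finset.sum_mul] at this
  simp only [lap, Finset.sum_sub_distrib]
  linarith

theorem max_rpow_sub_le {r : ℝ} (hr : 1 ≤ r) {a b : ℝ} (ha : 0 ≤ a) (hb : 0 ≤ b) :
    max (a ^ r - b ^ r) 0 ≤ r * (a ^ (r - 1) * max (a - b) 0) := by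
  have hnn : 0 ≤ r * (a ^ (r - 1) * max (a - b) 0) :=
    mul_nonneg (by linarith) (mul_nonneg (Real.rpow_nonneg ha _) (le_max_right _ _))
  refine max_le ?_ hnn
  rcases le_total a b with h | h
  · linarith [Real.rpow_le_rpow ha h (by linarith : 0 ≤ r)]
  rcases ha.eq_or_lt with rfl | ha
  · have : b = 0 := le_antisymm h hb
    subst this
    simp
  rw [max_eq_left (by linarith)]
  have hbern := one_add_mul_self_le_rpow_one_add (s := b / a - 1)
    (by linarith [div_nonneg hb ha.le]) hr
  rw [add_sub_cancel, Real.div_rpow hb ha.le, le_div_iff₀ (Real.rpow_pos_of_pos ha _)] at hbern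
  have : a ^ r = a ^ (r - 1) * a := by
    rw [← Real.rpow_add_one ha.ne', sub_add_cancel]
  rw [this] at hbern ⊢
  have e : (1 + r * (b / a - 1)) * (a ^ (r - 1) * a) =
      a ^ (r - 1) * a - r * (a ^ (r - 1) * (a - b)) := by
    field_simp
    ring
  linarith

/-- A priori estimate `‖u‖_Q ≤ C ‖Δu‖_q` for finitely supported functions, with
`1/q = 2/d + 1/Q`. -/
theorem elliptic_estimate (G : LFGraph X) {D : ℕ} (hval : G.BddVal D) {d : ℝ} (hd : 2 < d)
    (hIS : G.ISdim d) {Q : ℝ} (hQ0 : 0 < Q) (hQ : 2 ≤ Q * (d - 2) / d) {q : ℝ}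
    (hq : 1 / q = 2 / d + 1 / Q) :
    ∃ C : ℝ, 0 ≤ C ∧ ∀ (A : Finset X) (u : X → ℝ), (∀ x, x ∉ A → u x = 0) →
      ∑ x ∈ A, |u x| ^ Q ≤ (C * (∑ x ∈ A, |G.lap u x| ^ q) ^ (1 / q)) ^ Q := by
  obtain ⟨κ, hκ, hiso⟩ := hIS
  have hd0 : 0 < d := by linarith
  have hd1 : 0 < d - 1 := by linarith
  obtain ⟨s, hs⟩ : ∃ s, s = Q * (d - 2) / d := ⟨_, rfl⟩
  obtain ⟨r, hr⟩ : ∃ r, r = Q * (d - 1) / d := ⟨_, rfl⟩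
  obtain ⟨α, hα⟩ : ∃ α, α = d / (d - 1) := ⟨_, rfl⟩
  rw [← hs] at hQ
  have hrs : 2 * r - s = Q := by rw [hr, hs]; field_simp; ring
  have hrα : r * α = Q := by rw [hr, hα]; field_simp
  have hsQ : s < Q := by rw [hs, div_lt_iff₀ hd0]; nlinarith
  have hr1 : 1 ≤ r := by linarith
  have hα1 : 1 ≤ α := by rw [hα, le_div_iff₀ hd1]; linarith
  have hα' : 1 / α = 1 - 1 / d := by rw [hα]; field_simp
  have hα0 : 0 < α := by linarith
  have hconj : q.HolderConjugate (Q / (s - 1)) := by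
    rw [Real.holderConjugate_comm, Real.holderConjugate_iff]
    refine ⟨by rw [lt_div_iff₀ (by linarith)]; linarith, ?_⟩
    rw [← one_div q, hq, inv_div, hs]
    field_simp
    ring
  refine ⟨κ ^ 2 * r ^ 2 * D, by positivity, fun A u hA => ?_⟩
  set S := ∑ x ∈ A, |u x| ^ Q with hS
  set F := (∑ x ∈ A, |G.lap u x| ^ q) ^ (1 / q) with hF
  have hF0 : 0 ≤ F := Real.rpow_nonneg
    (Finset.sum_nonneg fun x _ => Real.rpow_nonneg (abs_nonneg _) _) _
  have hS0 : 0 ≤ S := Finset.sum_nonneg fun x _ => Real.rpow_nonneg (abs_nonneg _) _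
  have hsob := G.sobolev_of_isoperimetric hα1 (fun A hA => by rw [hα']; exact hiso A hA) A
    (fun x => |u x| ^ r) (fun x => Real.rpow_nonneg (abs_nonneg _) _)
    (fun x hx => by simp [hA x hx, Real.zero_rpow (by linarith : r ≠ 0)])
  have hSv : ∑ x ∈ A, (|u x| ^ r) ^ α = S :=
    Finset.sum_congr rfl fun x _ => by rw [← Real.rpow_mul (abs_nonneg _), hrα]
  rw [hSv] at hsob
  set E := ∑ x ∈ A, ∑ y ∈ G.nbr x, |u x| ^ (s - 2) * max (|u x| - |u y|) 0 ^ 2 with hE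
  have hEF : E ≤ F * S ^ ((s - 1) / Q) := by
    refine (G.energy_le hQ A u hA).trans ?_
    have hH := Real.inner_le_Lp_mul_Lq A (fun x => G.lap u x)
      (fun x => |u x| ^ (s - 2) * u x) hconj
    refine hH.trans (le_of_eq ?_)
    rw [one_div_div]
    congr 2
    refine Finset.sum_congr rfl fun x _ => ?_
    rw [abs_mul, abs_of_nonneg (Real.rpow_nonneg (abs_nonneg _) _)]
    rcases (abs_nonneg (u x)).eq_or_lt with h0 | h0
    · rw [← h0, mul_zero, Real.zero_rpow hQ0.ne',
        Real.zero_rpow (div_pos hQ0 (by linarith)).ne']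
    · rw [← Real.rpow_add_one h0.ne', ← Real.rpow_mul h0.le]
      congr 1
      have : s - 1 ≠ 0 := by linarith
      field_simp
      ring
  have hgrad : ∑ x ∈ A, ∑ y ∈ G.nbr x, max (|u x| ^ r - |u y| ^ r) 0 ≤
      r * ∑ x ∈ A, ∑ y ∈ G.nbr x,
        (|u x| ^ ((s - 2) / 2) * max (|u x| - |u y|) 0) * |u x| ^ (Q / 2) := by
    rw [Finset.mul_sum]
    refine Finset.sum_le_sum fun x _ => ?_
    rw [Finset.mul_sum]
    refine Finset.sum_le_sum fun y _ => ?_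
    refine (max_rpow_sub_le hr1 (abs_nonneg _) (abs_nonneg _)).trans (le_of_eq ?_)
    rcases (abs_nonneg (u x)).eq_or_lt with h0 | h0
    · rw [← h0, max_eq_right (by linarith [abs_nonneg (u y)])]
      ring
    · have : |u x| ^ (r - 1) = |u x| ^ ((s - 2) / 2) * |u x| ^ (Q / 2) := by
        rw [← Real.rpow_add h0]
        congr 1
        linarith
      rw [this]
      ring
  have hCS : (∑ x ∈ A, ∑ y ∈ G.nbr x,
        (|u x| ^ ((s - 2) / 2) * max (|u x| - |u y|) 0) * |u x| ^ (Q / 2)) ^ 2 ≤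
      E * (D * S) := by
    have hsq : ∀ (x : X) (t : ℝ), (|u x| ^ (t / 2)) ^ 2 = |u x| ^ t := fun x t => by
      rw [← Real.rpow_natCast, ← Real.rpow_mul (abs_nonneg _)]
      congr 1
      push_cast
      ring
    have h := Finset.sum_mul_sq_le_sq_mul_sq (A.sigma G.nbr)
      (fun e => |u e.1| ^ ((s - 2) / 2) * max (|u e.1| - |u e.2|) 0)
      (fun e => |u e.1| ^ (Q / 2))
    simp only [Finset.sum_sigma, mul_pow, hsq] at h
    refine h.trans (mul_le_mul_of_nonneg_left ?_ ?_)
    · rw [hS, Finset.mul_sum]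
      refine Finset.sum_le_sum fun x _ => ?_
      rw [Finset.sum_const, nsmul_eq_mul]
      exact mul_le_mul_of_nonneg_right (by exact_mod_cast hval x)
        (Real.rpow_nonneg (abs_nonneg _) _)
    · exact Finset.sum_nonneg fun x _ => Finset.sum_nonneg fun y _ =>
        mul_nonneg (Real.rpow_nonneg (abs_nonneg _) _) (sq_nonneg _)
  rcases hS0.eq_or_lt with h0 | hpos
  · rw [← h0]
    positivity
  set Z := ∑ x ∈ A, ∑ y ∈ G.nbr x,
        (|u x| ^ ((s - 2) / 2) * max (|u x| - |u y|) 0) * |u x| ^ (Q / 2)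
  have h1 : S ^ (1 / α) ≤ κ * (r * Z) :=
    hsob.trans (mul_le_mul_of_nonneg_left hgrad hκ.le)
  have h2 : (S ^ (1 / α)) ^ 2 ≤ κ ^ 2 * r ^ 2 * D * F * (S ^ ((s - 1) / Q) * S) := by
    calc (S ^ (1 / α)) ^ 2 ≤ (κ * (r * Z)) ^ 2 :=
          pow_le_pow_left₀ (Real.rpow_nonneg hS0 _) h1 2
      _ = κ ^ 2 * r ^ 2 * Z ^ 2 := by ring
      _ ≤ κ ^ 2 * r ^ 2 * (F * S ^ ((s - 1) / Q) * (D * S)) := by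
          refine mul_le_mul_of_nonneg_left (hCS.trans ?_) (by positivity)
          exact mul_le_mul_of_nonneg_right hEF (by positivity)
      _ = _ := by ring
  have h3 : (S ^ (1 / α)) ^ 2 = S ^ (1 / Q) * (S ^ ((s - 1) / Q) * S) := by
    rw [← Real.rpow_add_one hpos.ne', ← Real.rpow_add hpos, ← Real.rpow_natCast,
      ← Real.rpow_mul hS0, hα', hs]
    congr 1
    push_cast
    field_simp
    ring
  rw [h3] at h2
  have h4 : S ^ (1 / Q) ≤ κ ^ 2 * r ^ 2 * D * F := le_of_mul_le_mul_right h2 (by positivity)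
  calc S = (S ^ (1 / Q)) ^ Q := by
        rw [← Real.rpow_mul hS0, one_div_mul_cancel hQ0.ne', Real.rpow_one]
    _ ≤ _ := Real.rpow_le_rpow (by positivity) h4 hQ0.le

theorem exists_dirichlet_solution (G : LFGraph X) (A : Finset X)
    (hinj : ∀ u : X → ℝ, (∀ x, x ∉ A → u x = 0) → (∀ x ∈ A, G.lap u x = 0) → ∀ x ∈ A, u x = 0)
    (f : X → ℝ) : ∃ u : X → ℝ, (∀ x, x ∉ A → u x = 0) ∧ ∀ x ∈ A, G.lap u x = f x := by
  classical
  let ext : (A → ℝ) → X → ℝ := fun w x => if h : x ∈ A then w ⟨x, h⟩ else 0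
  have hext : ∀ w x, x ∉ A → ext w x = 0 := fun w x hx => by simp [ext, hx]
  let T : (A → ℝ) →ₗ[ℝ] (A → ℝ) :=
    { toFun := fun w x => G.lap (ext w) x
      map_add' := fun w w' => by
        have : ∀ x, ext (w + w') x = ext w x + ext w' x := fun x => by
          by_cases hx : x ∈ A <;> simp [ext, hx]
        funext x
        simp only [lap, this, Pi.add_apply, ← Finset.sum_add_distrib]
        exact Finset.sum_congr rfl fun y _ => by ring
      map_smul' := fun a w => by
        have : ∀ x, ext (a • w) x = a * ext w x := fun x => by
          by_cases hx : x ∈ A <;> simp [ext, hx]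
        funext x
        simp only [lap, this, Pi.smul_apply, smul_eq_mul, RingHom.id_apply, Finset.mul_sum]
        exact Finset.sum_congr rfl fun y _ => by ring }
  have hT : Function.Injective T := by
    rw [injective_iff_map_eq_zero]
    intro w hw
    funext x
    have := hinj (ext w) (hext w) (fun y hy => congrFun hw ⟨y, hy⟩) x x.2
    simpa [ext] using this
  obtain ⟨w, hw⟩ := LinearMap.injective_iff_surjective.1 hT fun x => f x
  exact ⟨ext w, hext w, fun x hx => congrFun hw ⟨x, hx⟩⟩

/-- An a priori estimate for finitely supported functions allows one to solve the Poisson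
equation by exhaustion. -/
theorem exists_potential (G : LFGraph X) {Q q C : ℝ} (hQ : 0 < Q) (hq : 0 < q) (hC : 0 ≤ C)
    (hest : ∀ (A : Finset X) (u : X → ℝ), (∀ x, x ∉ A → u x = 0) →
      ∑ x ∈ A, |u x| ^ Q ≤ (C * (∑ x ∈ A, |G.lap u x| ^ q) ^ (1 / q)) ^ Q)
    (f : X → ℝ) (hf : lpMem q f) :
    ∃ u : X → ℝ, (∀ x, G.lap u x = f x) ∧ lpMem Q u := by
  classical
  have hsol : ∀ A : Finset X, ∃ u : X → ℝ, (∀ x, x ∉ A → u x = 0) ∧ ∀ x ∈ A, G.lap u x = f x := by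
    refine fun A => G.exists_dirichlet_solution A (fun u hu hlap x hx => ?_) f
    have h := hest A u hu
    rw [Finset.sum_eq_zero (s := A) (f := fun x => |G.lap u x| ^ q)
      fun y hy => by rw [hlap y hy, abs_zero, Real.zero_rpow hq.ne'],
      Real.zero_rpow (one_div_pos.2 hq).ne', mul_zero, Real.zero_rpow hQ.ne'] at h
    have h' : |u x| ^ Q ≤ 0 := (Finset.single_le_sum (f := fun x => |u x| ^ Q)
      (fun y _ => Real.rpow_nonneg (abs_nonneg _) _) hx).trans h
    exact abs_eq_zero.1 ((Real.rpow_eq_zero (abs_nonneg _) hQ.ne').1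
      (le_antisymm h' (Real.rpow_nonneg (abs_nonneg _) _)))
  choose v hv0 hv using hsol
  set K := (C * (∑' x, |f x| ^ q) ^ (1 / q)) ^ Q
  have hK : ∀ A, ∑ x ∈ A, |v A x| ^ Q ≤ K := by
    intro A
    refine (hest A (v A) (hv0 A)).trans ?_
    rw [Finset.sum_congr rfl fun x hx => by rw [hv A x hx]]
    have h0 : 0 ≤ ∑ x ∈ A, |f x| ^ q :=
      Finset.sum_nonneg fun x _ => Real.rpow_nonneg (abs_nonneg _) _
    have h1 : ∑ x ∈ A, |f x| ^ q ≤ ∑' x, |f x| ^ q :=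
      Summable.sum_le_tsum A (fun x _ => Real.rpow_nonneg (abs_nonneg _) _) hf
    exact Real.rpow_le_rpow (mul_nonneg hC (Real.rpow_nonneg h0 _))
      (mul_le_mul_of_nonneg_left (Real.rpow_le_rpow h0 h1 (one_div_pos.2 hq).le) hC) hQ.le
  have hKT : ∀ A T : Finset X, ∑ x ∈ T, |v A x| ^ Q ≤ K := by
    intro A T
    have h : ∑ x ∈ T, |v A x| ^ Q = ∑ x ∈ T ∩ A, |v A x| ^ Q := by
      refine (Finset.sum_subset Finset.inter_subset_left fun x hx hx' => ?_).symm
      rw [hv0 A x fun h => hx' (Finset.mem_inter.2 ⟨hx, h⟩), abs_zero, Real.zero_rpow hQ.ne']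
    rw [h]
    exact (Finset.sum_le_sum_of_subset_of_nonneg Finset.inter_subset_right
      fun x _ _ => Real.rpow_nonneg (abs_nonneg _) _).trans (hK A)
  have hbd : ∀ (A : Finset X) (x : X), v A x ∈ Set.Icc (-K ^ (1 / Q)) (K ^ (1 / Q)) := by
    intro A x
    rw [Set.mem_Icc, ← abs_le]
    have h := hKT A {x}
    rw [Finset.sum_singleton] at h
    have h' := Real.rpow_le_rpow (Real.rpow_nonneg (abs_nonneg _) _) h (one_div_pos.2 hQ).le
    rwa [← Real.rpow_mul (abs_nonneg _), mul_one_div_cancel hQ.ne', Real.rpow_one] at h'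
  let U : Ultrafilter (Finset X) := Ultrafilter.of atTop
  have hlim : ∀ x, ∃ a, Tendsto (fun A => v A x) U (𝓝 a) := by
    intro x
    obtain ⟨a, -, ha⟩ := isCompact_Icc.ultrafilter_le_nhds' (U.map fun A => v A x)
      (Ultrafilter.mem_map.2 (Filter.univ_mem' fun A => hbd A x))
    exact ⟨a, ha⟩
  choose u hu using hlim
  refine ⟨u, fun x => ?_, ?_⟩
  · have h1 : Tendsto (fun A => G.lap (v A) x) U (𝓝 (G.lap u x)) :=
      tendsto_finsetSum _ fun y _ => (hu x).sub (hu y)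
    have h2 : (fun A => G.lap (v A) x) =ᶠ[U] fun _ => f x := by
      have : ∀ᶠ A : Finset X in atTop, x ∈ A :=
        (eventually_ge_atTop {x}).mono fun A hA => hA (Finset.mem_singleton_self x)
      exact (this.filter_mono (Ultrafilter.of_le _)).mono fun A hA => hv A x hA
    exact tendsto_nhds_unique h1 (tendsto_const_nhds.congr' h2.symm)
  · refine summable_of_sum_le (c := K) (fun x => Real.rpow_nonneg (abs_nonneg _) _) fun T => ?_
    have h1 : Tendsto (fun A => ∑ x ∈ T, |v A x| ^ Q) U (𝓝 (∑ x ∈ T, |u x| ^ Q)) :=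
      tendsto_finsetSum _ fun y _ => (hu y).abs.rpow_const (Or.inr hQ.le)
    exact le_of_tendsto h1 (Filter.Eventually.of_forall fun A => hKT A T)

theorem lpMem_of_le {ι : Type*} {p q : ℝ} (hp : 0 < p) (hpq : p ≤ q) {f : ι → ℝ}
    (hf : lpMem p f) : lpMem q f := by
  refine Summable.of_norm_bounded_eventually hf ?_
  filter_upwards [hf.tendsto_cofinite_zero.eventually_le_const one_pos] with i hi
  rw [Real.norm_of_nonneg (Real.rpow_nonneg (abs_nonneg _) _)]
  have h1 : |f i| ≤ 1 := by
    by_contra! h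
    linarith [Real.one_lt_rpow h hp]
  exact Real.rpow_le_rpow_of_exponent_ge' (abs_nonneg _) h1 hp.le hpq

theorem lpMem_finite_lt {ι : Type*} {p : ℝ} (hp : 0 < p) {f : ι → ℝ} (hf : lpMem p f)
    {ε : ℝ} (hε : 0 < ε) : {i | ε < |f i|}.Finite := by
  have h := hf.tendsto_cofinite_zero.eventually_le_const (Real.rpow_pos_of_pos hε p)
  refine (Filter.eventually_cofinite.1 h).subset fun i hi => ?_
  exact not_le.2 (Real.rpow_lt_rpow hε.le hi hp)

theorem lpMem_lap (G : LFGraph X) {D : ℕ} (hval : G.BddVal D) {p : ℝ} (hp : 1 ≤ p) {g : X → ℝ}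
    (hg : G.MemDp p g) : lpMem p (G.lap g) := by
  classical
  let F : X × X → ℝ := fun e => |g e.2 - g e.1| ^ p
  let E : Set (X × X) := {e | e.2 ∈ G.nbr e.1}
  have hF : Summable (E.indicator F) := summable_subtype_iff_indicator.1 hg
  have hF0 : ∀ e, 0 ≤ E.indicator F e :=
    Set.indicator_nonneg fun e _ => Real.rpow_nonneg (abs_nonneg _) _
  refine summable_of_sum_le (c := (D : ℝ) ^ (p - 1) * ∑' e, E.indicator F e)
    (fun x => Real.rpow_nonneg (abs_nonneg _) _) fun T => ?_
  have h1 : ∀ x, |G.lap g x| ^ p ≤ (D : ℝ) ^ (p - 1) * ∑ y ∈ G.nbr x, E.indicator F (x, y) := by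
    intro x
    calc |G.lap g x| ^ p ≤ (∑ y ∈ G.nbr x, |g x - g y|) ^ p :=
          Real.rpow_le_rpow (abs_nonneg _) (Finset.abs_sum_le_sum_abs _ _) (by linarith)
      _ ≤ ((G.nbr x).card : ℝ) ^ (p - 1) * ∑ y ∈ G.nbr x, |g x - g y| ^ p :=
          Real.rpow_sum_le_const_mul_sum_rpow _ _ hp
      _ = ((G.nbr x).card : ℝ) ^ (p - 1) * ∑ y ∈ G.nbr x, E.indicator F (x, y) := by
          congr 1
          refine Finset.sum_congr rfl fun y hy => ?_
          rw [Set.indicator_of_mem (show (x, y) ∈ E from hy), abs_sub_comm]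
      _ ≤ _ := mul_le_mul_of_nonneg_right
          (Real.rpow_le_rpow (Nat.cast_nonneg _) (by exact_mod_cast hval x) (by linarith))
          (Finset.sum_nonneg fun y _ => hF0 _)
  refine (Finset.sum_le_sum fun x _ => h1 x).trans ?_
  rw [← Finset.mul_sum]
  refine mul_le_mul_of_nonneg_left ?_ (by positivity)
  rw [← Finset.sum_finset_product' ((T.sigma G.nbr).map (Equiv.sigmaEquivProd X X).toEmbedding)
    T G.nbr (f := fun x y => E.indicator F (x, y)) (by
      rintro ⟨x, y⟩
      simp)]
  exact Summable.sum_le_tsum _ (fun e _ => hF0 e) hF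

/-- On a Liouville graph with `IS_d`, a bounded function with `p`-summable gradient, `p < d/2`,
is constant up to a `Q`-summable function. -/
theorem exists_const_add_lpMem (G : LFGraph X) {D : ℕ} (hval : G.BddVal D)
    {d : ℝ} (hIS : G.ISdim d) (hLiou : G.Liouville)
    {p : ℝ} (hp : 1 ≤ p) (hpd : p < d / 2) (e0 : X)
    {g : X → ℝ} (hg : G.MemDp p g) (hb : BoundedFun g) :
    ∃ (c : ℝ) (u : X → ℝ) (Q : ℝ), 0 < Q ∧ lpMem Q u ∧ ∀ x, g x = c + u x := by
  have hd : 2 < d := by linarith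
  have hd2 : 0 < d - 2 := by linarith
  have hgap : 0 < 1 / p - 2 / d := by
    rw [sub_pos, div_lt_div_iff₀ (by linarith) (by linarith)]
    linarith
  obtain ⟨Q, hQ1, hQ2⟩ : ∃ Q, 2 * d / (d - 2) ≤ Q ∧ 1 / (1 / p - 2 / d) ≤ Q :=
    ⟨_, le_max_left _ _, le_max_right _ _⟩
  have hQ0 : 0 < Q := (div_pos (by linarith) hd2).trans_le hQ1
  have hQ : 2 ≤ Q * (d - 2) / d := by
    rw [div_le_iff₀ hd2] at hQ1
    rwa [le_div_iff₀ (by linarith)]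
  have hpos : 0 < 2 / d + 1 / Q := by positivity
  have hpq : p ≤ 1 / (2 / d + 1 / Q) := by
    rw [le_one_div (by linarith) hpos]
    have := (one_div_le hgap hQ0).1 hQ2
    linarith
  obtain ⟨C, hC, hest⟩ := G.elliptic_estimate hval hd hIS hQ0 hQ (one_div_one_div (2 / d + 1 / Q))
  obtain ⟨u, hu, huQ⟩ := G.exists_potential hQ0 (one_div_pos.2 hpos) hC hest (G.lap g)
    (lpMem_of_le (by linarith) hpq (G.lpMem_lap hval hp hg))
  have hharm : G.Harmonic fun x => g x - u x := by
    intro x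
    have h := hu x
    simp only [lap, Finset.sum_sub_distrib, Finset.sum_const, nsmul_eq_mul] at h
    simp only [Finset.sum_sub_distrib]
    linarith
  have hub : BoundedFun u := by
    have hfin := lpMem_finite_lt hQ0 huQ one_pos
    obtain ⟨M, hM⟩ := (hfin.image fun x => |u x|).bddAbove
    refine ⟨max 1 M, fun x => ?_⟩
    by_cases hx : 1 < |u x|
    · exact (hM ⟨x, hx, rfl⟩).trans (le_max_right _ _)
    · exact (not_lt.1 hx).trans (le_max_left _ _)
  obtain ⟨M, hM⟩ := hb
  obtain ⟨N, hN⟩ := hub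
  have hconst := hLiou _ hharm ⟨M + N, fun x => (abs_sub _ _).trans (add_le_add (hM x) (hN x))⟩
  refine ⟨g e0 - u e0, u, Q, hQ0, huQ, fun x => ?_⟩
  linarith [hconst x e0]

end LFGraph

/-- Truncation of a real number to the interval `[-K, K]`. -/
def clamp (K t : ℝ) : ℝ := max (-K) (min K t)

theorem abs_clamp_le {K : ℝ} (hK : 0 ≤ K) (t : ℝ) : |clamp K t| ≤ K :=
  abs_le.2 ⟨le_max_left _ _, max_le (by linarith) (min_le_left _ _)⟩

theorem clamp_of_abs_le {K t : ℝ} (h : |t| ≤ K) : clamp K t = t := by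
  rw [clamp, min_eq_right (abs_le.1 h).2, max_eq_right (abs_le.1 h).1]

theorem abs_clamp_sub_clamp_le (K s t : ℝ) : |clamp K s - clamp K t| ≤ |s - t| :=
  (abs_max_sub_max_le_max _ _ _ _).trans (max_le (by simp) ((abs_min_sub_min_le_max _ _ _ _).trans (by simp)))

/-- A Liouville graph with `IS_d` has trivial reduced
`ℓ^p`-cohomology in degree one for every `1 ≤ p < d/2`. -/
theorem stmt1 {X : Type*} (G : LFGraph X) (hconn : G.Conn) (D : ℕ) (hval : G.BddVal D)
    (d : ℝ) (hIS : G.ISdim d) (hLiou : G.Liouville)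
    (p : ℝ) (hp : 1 ≤ p) (hpd : p < d / 2) (e0 : X)
    (g : X → ℝ) (hg : G.MemDp p g) : G.InClos p e0 g := by
  have hp0 : 0 < p := by linarith
  have hclampD : ∀ n : ℕ, G.MemDp p fun x => clamp n (g x) := fun n =>
    Summable.of_nonneg_of_le (fun e => Real.rpow_nonneg (abs_nonneg _) _)
      (fun e => Real.rpow_le_rpow (abs_nonneg _) (abs_clamp_sub_clamp_le _ _ _) hp0.le) hg
  choose c u Q hQ huQ hu using fun n : ℕ => G.exists_const_add_lpMem hval hIS hLiou hp hpd e0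
    (hclampD n) ⟨n, fun x => abs_clamp_le (Nat.cast_nonneg n) (g x)⟩
  let δ : ℕ → ℝ := fun n => 1 / (n + 1)
  have hδ : ∀ n, 0 < δ n := fun n => Nat.one_div_pos_of_nat
  let f : ℕ → X → ℝ := fun n x => u n x - clamp (δ n) (u n x)
  let R : ℕ → X → ℝ := fun n x => g x - (f n x + c n)
  have hR : ∀ n x, R n x = g x - clamp n (g x) + clamp (δ n) (u n x) := fun n x => by
    simp only [R, f, hu n x]
    ring
  have hf : ∀ n, lpMem p (f n) := by
    refine fun n => summable_of_hasFiniteSupport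
      ((LFGraph.lpMem_finite_lt (hQ n) (huQ n) (hδ n)).subset fun x hx => ?_)
    by_contra h
    refine hx ?_
    simp only [f, clamp_of_abs_le (not_lt.1 h), sub_self, abs_zero, Real.zero_rpow hp0.ne']
  have hRlim : ∀ x, Tendsto (fun n => R n x) atTop (𝓝 0) := by
    intro x
    refine squeeze_zero_norm' ?_ tendsto_one_div_add_atTop_nhds_zero_nat
    filter_upwards [eventually_ge_atTop ⌈|g x|⌉₊] with n hn
    rw [hR, clamp_of_abs_le (Nat.ceil_le.1 hn), sub_self, zero_add]
    exact abs_clamp_le (hδ n).le _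
  have hbound : ∀ n (e : G.Edge), |G.grad (R n) e| ^ p ≤ 3 ^ p * |G.grad g e| ^ p := by
    intro n e
    rw [← Real.mul_rpow (by norm_num) (abs_nonneg _)]
    refine Real.rpow_le_rpow (abs_nonneg _) ?_ hp0.le
    have h1 := abs_clamp_sub_clamp_le n (g e.1.2) (g e.1.1)
    have h2 := abs_clamp_sub_clamp_le (δ n) (u n e.1.2) (u n e.1.1)
    have h3 : u n e.1.2 - u n e.1.1 = clamp n (g e.1.2) - clamp n (g e.1.1) := by
      rw [hu, hu]
      ring
    rw [h3] at h2
    have h4 : G.grad (R n) e = (g e.1.2 - g e.1.1) - (clamp n (g e.1.2) - clamp n (g e.1.1)) +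
        (clamp (δ n) (u n e.1.2) - clamp (δ n) (u n e.1.1)) := by
      simp only [LFGraph.grad, hR]
      ring
    rw [h4]
    refine (abs_add_le _ _).trans ?_
    have h5 := abs_sub (g e.1.2 - g e.1.1) (clamp n (g e.1.2) - clamp n (g e.1.1))
    simp only [LFGraph.grad]
    linarith
  have hsum : Summable fun e : G.Edge => 3 ^ p * |G.grad g e| ^ p := Summable.mul_left _ hg
  have hRD : ∀ n, G.MemDp p (R n) := fun n =>
    Summable.of_nonneg_of_le (fun e => Real.rpow_nonneg (abs_nonneg _) _) (hbound n) hsum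
  have hpow : ∀ {ι : Type _} {l : ι → ℝ} {F : Filter ι} {t : ℝ}, 0 < t → Tendsto l F (𝓝 0) →
      Tendsto (fun i => l i ^ t) F (𝓝 0) := fun {ι l F t} ht hl => by
    have := hl.rpow_const (p := t) (Or.inr ht.le)
    rwa [Real.zero_rpow ht.ne'] at this
  have htsum : Tendsto (fun n => ∑' e : G.Edge, |G.grad (R n) e| ^ p) atTop (𝓝 0) := by
    have := tendsto_tsum_of_dominated_convergence (𝓕 := atTop)
      (f := fun n (e : G.Edge) => |G.grad (R n) e| ^ p) (g := fun _ => 0) hsum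
      (fun e => hpow hp0 (by
        have := ((hRlim e.1.2).sub (hRlim e.1.1)).abs
        rwa [sub_zero, abs_zero] at this))
      (Filter.Eventually.of_forall fun n e => by
        rw [Real.norm_of_nonneg (Real.rpow_nonneg (abs_nonneg _) _)]
        exact hbound n e)
    rwa [tsum_zero] at this
  have hdist : Tendsto (fun n => G.dpDist p e0 g fun x => f n x + c n) atTop (𝓝 0) := by
    have h := (hpow (one_div_pos.2 hp0) htsum).add (hRlim e0).abs
    rwa [abs_zero, add_zero] at h
  intro ε hε
  obtain ⟨n, hn⟩ := (hdist.eventually_lt_const hε).exists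
  exact ⟨f n, c n, hf n, hRD n, hn⟩
end

section
/- Let G be a finitely generated group whose growth is at least polynomial of degree d (there is c > 0 with |B_n| ≥ c·n^d for all n ≥ 1, where B_n is the ball of radius n in a Cayley graph Γ of G with respect to a finite symmetric generating set), and assume Γ is Liouville (every bounded harmonic function for the simple random walk on Γ is constant). Then for every p with 1 ≤ p < d/2, the reduced ℓ^p-cohomology of Γ in degree one is trivial: D^p(Γ) equals the D^p-closure of ℓ^p(G) + ℝ·1. -/
open scoped BigOperators ENNReal NNReal
open Filter Topology

section LazyWalk

theorem Summable.mul_of_sq {ι : Type*} {f g : ι → ℝ} (hf : Summable fun i => f i ^ 2)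
    (hg : Summable fun i => g i ^ 2) : Summable fun i => f i * g i := by
  refine Summable.of_norm_bounded (hf.add hg) fun i => ?_
  rw [Real.norm_eq_abs, abs_le]
  constructor <;> nlinarith [sq_nonneg (f i + g i), sq_nonneg (f i - g i)]

theorem Summable.sq_of_nonneg {ι : Type*} {f : ι → ℝ} (hf : Summable f) (h0 : ∀ i, 0 ≤ f i) :
    Summable fun i => f i ^ 2 := by
  refine Summable.of_nonneg_of_le (fun i => sq_nonneg _) (fun i => ?_) (hf.mul_left (∑' j, f j))
  rw [sq]
  exact mul_le_mul_of_nonneg_right (hf.le_tsum i fun j _ => h0 j) (h0 i)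

variable {Γ : Type*} [Group Γ]

theorem Summable.comp_mul_left {f : Γ → ℝ} (hf : Summable f) (y : Γ) :
    Summable fun x => f (y * x) :=
  (Equiv.mulLeft y).summable_iff.mpr hf

theorem tsum_comp_mul_left (f : Γ → ℝ) (y : Γ) : ∑' x, f (y * x) = ∑' x, f x :=
  (Equiv.mulLeft y).tsum_eq f

theorem Summable.sq_translate_sub {f : Γ → ℝ} (hf : Summable fun x => f x ^ 2) (y : Γ) :
    Summable fun x => (f (y * x) - f x) ^ 2 := by
  have h := hf.comp_mul_left y
  refine Summable.of_nonneg_of_le (fun x => sq_nonneg _) (fun x => ?_) ((h.add hf).mul_left 2)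
  nlinarith [sq_nonneg (f (y * x) + f x)]

/-- The Markov operator of the lazy simple random walk on a Cayley graph. -/
noncomputable def lazyAvg (S : Finset Γ) (f : Γ → ℝ) (x : Γ) : ℝ :=
  ∑ s ∈ S, (f x + f (s * x)) / (2 * (S.card : ℝ))

/-- The Dirichlet energy of a function on a Cayley graph. -/
noncomputable def energy (S : Finset Γ) (f : Γ → ℝ) : ℝ :=
  ∑ s ∈ S, ∑' x, (f (s * x) - f x) ^ 2

variable {S : Finset Γ}

theorem energy_nonneg (f : Γ → ℝ) : 0 ≤ energy S f :=
  Finset.sum_nonneg fun _ _ => tsum_nonneg fun _ => sq_nonneg _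

theorem lazyAvg_nonneg {f : Γ → ℝ} (h0 : ∀ x, 0 ≤ f x) (x : Γ) : 0 ≤ lazyAvg S f x :=
  Finset.sum_nonneg fun s _ => div_nonneg (add_nonneg (h0 x) (h0 _)) (by positivity)

theorem Summable.lazyAvg {f : Γ → ℝ} (hf : Summable f) : Summable (lazyAvg S f) :=
  summable_sum fun s _ => (hf.add (hf.comp_mul_left s)).div_const _

theorem lazyAvg_sub_self (hS : S.Nonempty) (f : Γ → ℝ) (x : Γ) :
    f x - lazyAvg S f x = ∑ s ∈ S, (f x - f (s * x)) / (2 * (S.card : ℝ)) := by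
  have hc : (S.card : ℝ) ≠ 0 := by exact_mod_cast hS.card_pos.ne'
  have : f x = ∑ s ∈ S, (2 * f x) / (2 * (S.card : ℝ)) := by
    rw [Finset.sum_const, nsmul_eq_mul]; field_simp
  rw [lazyAvg]
  nth_rewrite 1 [this]
  rw [← Finset.sum_sub_distrib]
  refine Finset.sum_congr rfl fun s _ => ?_
  ring

theorem tsum_lazyAvg (hS : S.Nonempty) {f : Γ → ℝ} (hf : Summable f) :
    ∑' x, lazyAvg S f x = ∑' x, f x := by
  have hc : (S.card : ℝ) ≠ 0 := by exact_mod_cast hS.card_pos.ne'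
  simp only [lazyAvg]
  rw [Summable.tsum_finsetSum fun s _ => (hf.add (hf.comp_mul_left s)).div_const _]
  simp only [tsum_div_const]
  rw [Finset.sum_congr rfl fun s _ => by
    rw [hf.tsum_add (hf.comp_mul_left s), tsum_comp_mul_left]]
  rw [Finset.sum_const, nsmul_eq_mul]
  field_simp
  ring

theorem lazyAvg_rpow_le (hS : S.Nonempty) {p : ℝ} (hp : 1 ≤ p) (f : Γ → ℝ) (x : Γ) :
    |lazyAvg S f x| ^ p ≤ lazyAvg S (fun y => |f y| ^ p) x := by
  have hc : (0 : ℝ) < S.card := by exact_mod_cast hS.card_pos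
  have hpt : ∀ a b : ℝ, ((|a| + |b|) / 2) ^ p ≤ (|a| ^ p + |b| ^ p) / 2 := fun a b => by
    have h := (convexOn_rpow hp).2 (Set.mem_Ici.mpr (abs_nonneg a)) (Set.mem_Ici.mpr (abs_nonneg b))
      (by norm_num : (0 : ℝ) ≤ 1 / 2) (by norm_num : (0 : ℝ) ≤ 1 / 2) (by norm_num)
    simp only [smul_eq_mul] at h
    rw [show (|a| + |b|) / 2 = 1 / 2 * |a| + 1 / 2 * |b| by ring]
    linarith
  calc |lazyAvg S f x| ^ p
      ≤ (∑ s ∈ S, (1 / (S.card : ℝ)) * ((|f x| + |f (s * x)|) / 2)) ^ p := by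
        refine Real.rpow_le_rpow (abs_nonneg _) ?_ (by linarith)
        refine (Finset.abs_sum_le_sum_abs _ _).trans (Finset.sum_le_sum fun s _ => ?_)
        rw [abs_div, abs_of_pos (by positivity : (0 : ℝ) < 2 * S.card), div_le_iff₀ (by positivity)]
        field_simp
        exact abs_add_le _ _
    _ ≤ ∑ s ∈ S, (1 / (S.card : ℝ)) * ((|f x| + |f (s * x)|) / 2) ^ p := by
        refine Real.rpow_arith_mean_le_arith_mean_rpow S _ _ (fun _ _ => by positivity) ?_
          (fun _ _ => by positivity) hp
        rw [Finset.sum_const, nsmul_eq_mul]; field_simp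
    _ ≤ _ := by
        refine Finset.sum_le_sum fun s _ => ?_
        calc _ ≤ (1 / (S.card : ℝ)) * ((|f x| ^ p + |f (s * x)| ^ p) / 2) := by
              gcongr; exact hpt _ _
          _ = _ := by field_simp

theorem lazyAvg_sq_le (hS : S.Nonempty) (f : Γ → ℝ) (x : Γ) :
    lazyAvg S f x ^ 2 ≤
      ∑ s ∈ S, ((f x ^ 2 + f (s * x) ^ 2) / 2 - (f (s * x) - f x) ^ 2 / 4) / (S.card : ℝ) := by
  have hc : (0 : ℝ) < S.card := by exact_mod_cast hS.card_pos
  have h := sq_sum_le_card_mul_sum_sq (s := S) (f := fun s => (f x + f (s * x)) / (2 * (S.card : ℝ)))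
  refine h.trans (le_of_eq ?_)
  rw [Finset.mul_sum]
  refine Finset.sum_congr rfl fun s _ => ?_
  field_simp
  ring

theorem Summable.lazyAvg_sq (hS : S.Nonempty) {f : Γ → ℝ} (hf : Summable fun x => f x ^ 2) :
    Summable fun x => _root_.lazyAvg S f x ^ 2 :=
  Summable.of_nonneg_of_le (fun _ => sq_nonneg _) (lazyAvg_sq_le hS f)
    (summable_sum fun s _ => (((hf.add (hf.comp_mul_left s)).div_const _).sub
      ((hf.sq_translate_sub s).div_const _)).div_const _)

theorem tsum_lazyAvg_sq_le (hS : S.Nonempty) {f : Γ → ℝ} (hf : Summable fun x => f x ^ 2) :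
    ∑' x, lazyAvg S f x ^ 2 ≤ ∑' x, f x ^ 2 - energy S f / (4 * (S.card : ℝ)) := by
  have hc : (0 : ℝ) < S.card := by exact_mod_cast hS.card_pos
  have hs : ∀ s ∈ S, Summable fun x =>
      ((f x ^ 2 + f (s * x) ^ 2) / 2 - (f (s * x) - f x) ^ 2 / 4) / (S.card : ℝ) := fun s _ =>
    (((hf.add (hf.comp_mul_left s)).div_const _).sub
      ((hf.sq_translate_sub s).div_const _)).div_const _
  refine ((hf.lazyAvg_sq hS).tsum_le_tsum (lazyAvg_sq_le hS f) (summable_sum hs)).trans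
    (le_of_eq ?_)
  rw [Summable.tsum_finsetSum hs]
  have : ∀ s ∈ S, ∑' x, ((f x ^ 2 + f (s * x) ^ 2) / 2 - (f (s * x) - f x) ^ 2 / 4) / (S.card : ℝ)
      = (∑' x, f x ^ 2) / S.card - (∑' x, (f (s * x) - f x) ^ 2) / (4 * S.card) := fun s _ => by
    have hfs := hf.comp_mul_left s
    rw [tsum_div_const, ((hf.add hfs).div_const _).tsum_sub ((hf.sq_translate_sub s).div_const _),
      tsum_div_const, tsum_div_const, hf.tsum_add hfs, tsum_comp_mul_left (fun x => f x ^ 2)]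
    field_simp
    ring
  rw [Finset.sum_congr rfl this, Finset.sum_sub_distrib, ← Finset.sum_div, energy, Finset.sum_const,
    nsmul_eq_mul, Finset.sum_div]
  field_simp

theorem tsum_lazyAvg_mul (hsym : ∀ s ∈ S, s⁻¹ ∈ S) {f g : Γ → ℝ}
    (hf : Summable fun x => f x ^ 2) (hg : Summable fun x => g x ^ 2) :
    ∑' x, lazyAvg S f x * g x = ∑' x, f x * lazyAvg S g x := by
  have hfg : Summable fun x => f x * g x := hf.mul_of_sq hg
  have h1 : ∀ s, Summable fun x => f (s * x) * g x := fun s =>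
    (hf.comp_mul_left s).mul_of_sq hg
  have h2 : ∀ s, Summable fun x => f x * g (s * x) := fun s =>
    hf.mul_of_sq (hg.comp_mul_left s)
  have e1 : ∀ x, lazyAvg S f x * g x =
      ∑ s ∈ S, (f x * g x + f (s * x) * g x) / (2 * (S.card : ℝ)) := fun x => by
    rw [lazyAvg, Finset.sum_mul]; exact Finset.sum_congr rfl fun s _ => by ring
  have e2 : ∀ x, f x * lazyAvg S g x =
      ∑ s ∈ S, (f x * g x + f x * g (s * x)) / (2 * (S.card : ℝ)) := fun x => by
    rw [lazyAvg, Finset.mul_sum]; exact Finset.sum_congr rfl fun s _ => by ring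
  simp only [e1, e2]
  rw [Summable.tsum_finsetSum fun s _ => (hfg.add (h1 s)).div_const _,
    Summable.tsum_finsetSum fun s _ => (hfg.add (h2 s)).div_const _]
  refine Finset.sum_bij' (fun s _ => s⁻¹) (fun s _ => s⁻¹) hsym hsym (fun s _ => inv_inv s)
    (fun s _ => inv_inv s) fun s _ => ?_
  rw [tsum_div_const, tsum_div_const, hfg.tsum_add (h1 s), hfg.tsum_add (h2 s⁻¹),
    ← tsum_comp_mul_left (fun x => f x * g (s⁻¹ * x)) s]
  simp

theorem tsum_sq_translate_sub_le [DecidableEq Γ] {f : Γ → ℝ} (hf : Summable fun x => f x ^ 2)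
    (n : ℕ) (y : Γ) (hy : y ∈ cball S n) :
    ∑' x, (f (y * x) - f x) ^ 2 ≤ (n : ℝ) ^ 2 * energy S f := by
  induction n generalizing y with
  | zero => simp only [cball, Finset.mem_singleton] at hy; simp [hy]
  | succ n ih =>
    have hE := energy_nonneg (S := S) f
    simp only [cball, Finset.mem_union, Finset.mem_biUnion, Finset.mem_image] at hy
    rcases hy with hy | ⟨z, hz, s, hs, rfl⟩
    · refine (ih y hy).trans ?_
      gcongr
      simp
    · have hz' := ih z hz
      have hs' : ∑' x, (f (s * x) - f x) ^ 2 ≤ energy S f :=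
        Finset.single_le_sum (f := fun s => ∑' x, (f (s * x) - f x) ^ 2)
          (fun _ _ => tsum_nonneg fun _ => sq_nonneg _) hs
      rcases Nat.eq_zero_or_pos n with rfl | hn
      · simp only [cball, Finset.mem_singleton] at hz
        simpa [hz] using hs'
      have hn' : (0 : ℝ) < n := by exact_mod_cast hn
      have hsz := (hf.sq_translate_sub s).comp_mul_left z
      have hle := (hf.sq_translate_sub (s * z)).tsum_le_tsum
        (g := fun x => (1 + (n : ℝ)) * (f (s * (z * x)) - f (z * x)) ^ 2 +
          (1 + 1 / (n : ℝ)) * (f (z * x) - f x) ^ 2) (fun x => by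
          rw [mul_assoc]
          set a := f (s * (z * x)) - f (z * x)
          set b := f (z * x) - f x
          have : f (s * (z * x)) - f x = a + b := by ring
          rw [this]
          have : (1 + (n : ℝ)) * a ^ 2 + (1 + 1 / (n : ℝ)) * b ^ 2 - (a + b) ^ 2
            = (n * a - b) ^ 2 / n := by field_simp; ring
          have h0 : 0 ≤ (n * a - b) ^ 2 / n := by positivity
          linarith) ((hsz.mul_left _).add ((hf.sq_translate_sub z).mul_left _))
      refine hle.trans ?_
      rw [(hsz.mul_left _).tsum_add ((hf.sq_translate_sub z).mul_left _), tsum_mul_left,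
        tsum_mul_left, tsum_comp_mul_left (fun x => (f (s * x) - f x) ^ 2) z]
      calc _ ≤ (1 + (n : ℝ)) * energy S f + (1 + 1 / (n : ℝ)) * ((n : ℝ) ^ 2 * energy S f) := by
            gcongr
        _ = _ := by push_cast; field_simp; ring

theorem one_mem_cball [DecidableEq Γ] (n : ℕ) : (1 : Γ) ∈ cball S n := by
  induction n with
  | zero => simp [cball]
  | succ n ih => exact Finset.mem_union_left _ ih

theorem tsum_sq_le_of_cball [DecidableEq Γ] {f : Γ → ℝ} (hf : Summable f) (h0 : ∀ x, 0 ≤ f x)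
    (h1 : ∑' x, f x = 1) (r : ℕ) :
    ∑' x, f x ^ 2 ≤ 1 / ((cball S r).card : ℝ) + (r : ℝ) ^ 2 * energy S f / 2 := by
  have hf2 := hf.sq_of_nonneg h0
  have hB : (0 : ℝ) < (cball S r).card := by
    exact_mod_cast Finset.card_pos.mpr ⟨1, one_mem_cball r⟩
  have hm : ∀ y, Summable fun x => f x * f (y * x) := fun y => hf2.mul_of_sq (hf2.comp_mul_left y)
  have key : ∀ y ∈ cball S r, ∑' x, f x ^ 2 ≤
      ∑' x, f x * f (y * x) + (r : ℝ) ^ 2 * energy S f / 2 := fun y hy => by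
    have h := tsum_sq_translate_sub_le hf2 r y hy
    have : ∑' x, (f (y * x) - f x) ^ 2 =
        ∑' x, f x ^ 2 + ∑' x, f x ^ 2 - 2 * ∑' x, f x * f (y * x) := by
      nth_rewrite 1 [← tsum_comp_mul_left (fun x => f x ^ 2) y]
      rw [← (hf2.comp_mul_left y).tsum_add hf2, ← tsum_mul_left,
        ← ((hf2.comp_mul_left y).add hf2).tsum_sub ((hm y).mul_left 2)]
      exact tsum_congr fun x => by ring
    linarith
  have hsum : ∑ y ∈ cball S r, ∑' x, f x * f (y * x) ≤ 1 := by
    rw [← Summable.tsum_finsetSum fun y _ => hm y, ← h1]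
    refine Summable.tsum_le_tsum (fun x => ?_) (summable_sum fun y _ => hm y) hf
    rw [← Finset.mul_sum]
    refine mul_le_of_le_one_right (h0 x) ?_
    have hx : Summable fun y => f (y * x) := (Equiv.mulRight x).summable_iff.mpr hf
    refine (hx.sum_le_tsum _ fun y _ => h0 _).trans (le_of_eq ?_)
    rw [← h1]
    exact (Equiv.mulRight x).tsum_eq f
  have h := Finset.sum_le_sum key
  rw [Finset.sum_add_distrib, Finset.sum_const, Finset.sum_const, nsmul_eq_mul, nsmul_eq_mul] at h
  have : ((cball S r).card : ℝ) * (∑' x, f x ^ 2) ≤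
      ((cball S r).card : ℝ) * (1 / ((cball S r).card : ℝ) + (r : ℝ) ^ 2 * energy S f / 2) := by
    rw [mul_add, mul_one_div_cancel hB.ne']; linarith
  exact le_of_mul_le_mul_left this hB

theorem le_rpow_of_decay {a : ℕ → ℝ} {κ α : ℝ} (hκ : 0 < κ) (hα : 0 < α) (hpos : ∀ n, 0 < a n)
    (h0 : a 0 ≤ 1) (hstep : ∀ n, a (n + 1) ≤ a n * (1 - κ * a n ^ α)) (n : ℕ) :
    a n ≤ (min 1 (κ * α) * ((n : ℝ) + 1)) ^ (-(1 / α)) := by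
  set μ := min 1 (κ * α) with hμ
  have hμ0 : 0 < μ := lt_min one_pos (by positivity)
  have key : ∀ n : ℕ, μ * ((n : ℝ) + 1) ≤ a n ^ (-α) := by
    intro n
    induction n with
    | zero =>
      have : 1 ≤ a 0 ^ (-α) := Real.one_le_rpow_of_pos_of_le_one_of_nonpos (hpos 0) h0 (by linarith)
      have h1 : μ ≤ 1 := min_le_left _ _
      push_cast
      linarith
    | succ n ih =>
      have hle : a (n + 1) ≤ a n * Real.exp (-(κ * a n ^ α)) :=
        (hstep n).trans (mul_le_mul_of_nonneg_left (Real.one_sub_le_exp_neg _) (hpos n).le)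
      have h1 := Real.rpow_le_rpow_of_nonpos (hpos (n + 1)) hle (by linarith : -α ≤ 0)
      rw [Real.mul_rpow (hpos n).le (Real.exp_pos _).le, ← Real.exp_mul] at h1
      have h2 : κ * α * a n ^ α + 1 ≤ Real.exp (-(κ * a n ^ α) * -α) :=
        le_trans (le_of_eq (by ring)) (Real.add_one_le_exp _)
      have h3 : a n ^ (-α) * (κ * α * a n ^ α + 1) = κ * α + a n ^ (-α) := by
        have : a n ^ (-α) * a n ^ α = 1 := by
          rw [← Real.rpow_add (hpos n)]; simp
        linear_combination (κ * α) * this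
      have h4 := mul_le_mul_of_nonneg_left h2 (Real.rpow_nonneg (hpos n).le (-α))
      have h5 : μ ≤ κ * α := min_le_right _ _
      push_cast
      linarith
  have h := Real.rpow_le_rpow_of_nonpos (by positivity) (key n)
    (by have := one_div_pos.mpr hα; linarith : -(1 / α) ≤ 0)
  rwa [← Real.rpow_mul (hpos n).le, show -α * -(1 / α) = 1 by field_simp, Real.rpow_one] at h

theorem tsum_lazyAvg_sq_le_of_growth [DecidableEq Γ] (hS : S.Nonempty) {d c : ℝ} (hd : 0 < d)
    (hc : 0 < c) (hc1 : c ≤ 1)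
    (hgrowth : ∀ n : ℕ, 1 ≤ n → c * (n : ℝ) ^ d ≤ ((cball S n).card : ℝ))
    {f : Γ → ℝ} (hf : Summable f) (h0 : ∀ x, 0 ≤ f x) (h1 : ∑' x, f x = 1)
    (hpos : 0 < ∑' x, f x ^ 2) (hle : ∑' x, f x ^ 2 ≤ 1) :
    ∑' x, lazyAvg S f x ^ 2 ≤ (∑' x, f x ^ 2) *
      (1 - (c / 2) ^ (2 / d) / (16 * (S.card : ℝ)) * (∑' x, f x ^ 2) ^ (2 / d)) := by
  have hSc : (0 : ℝ) < S.card := by exact_mod_cast hS.card_pos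
  have hdec := tsum_lazyAvg_sq_le hS (hf.sq_of_nonneg h0)
  have hball := tsum_sq_le_of_cball (S := S) hf h0 h1
  set E := ∑' x, f x ^ 2 with hE
  set t := (2 / (c * E)) ^ (1 / d) with ht
  have hcE : 0 < c * E := mul_pos hc hpos
  have ht1 : 1 ≤ t := by
    refine Real.one_le_rpow ?_ (by positivity)
    rw [le_div_iff₀ hcE]
    nlinarith
  set r := ⌈t⌉₊ with hr
  have htr : t ≤ r := Nat.le_ceil t
  have hrt : (r : ℝ) ≤ 2 * t := by
    have := Nat.ceil_lt_add_one (by linarith : 0 ≤ t)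
    linarith
  have hr1 : 1 ≤ r := by exact_mod_cast ht1.trans htr
  have htd : t ^ d = 2 / (c * E) := by
    rw [ht, ← Real.rpow_mul (by positivity), one_div_mul_cancel hd.ne', Real.rpow_one]
  have hB : 2 / E ≤ ((cball S r).card : ℝ) := by
    refine le_trans ?_ (hgrowth r hr1)
    calc 2 / E = c * t ^ d := by rw [htd]; field_simp
      _ ≤ c * (r : ℝ) ^ d := by gcongr
  have hB' : 1 / ((cball S r).card : ℝ) ≤ E / 2 := by
    calc 1 / ((cball S r).card : ℝ) ≤ 1 / (2 / E) := by gcongr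
      _ = E / 2 := by field_simp
  have hen := energy_nonneg (S := S) f
  have hEe : E ≤ (r : ℝ) ^ 2 * energy S f := by linarith [hball r]
  have ht2 : t ^ 2 * ((c / 2) ^ (2 / d) * E ^ (2 / d)) = 1 := by
    rw [← Real.mul_rpow (by positivity) hpos.le, ht, ← Real.rpow_natCast, ← Real.rpow_mul (by positivity),
      show 1 / d * ((2 : ℕ) : ℝ) = 2 / d by push_cast; ring, ← Real.mul_rpow (by positivity) (by positivity),
      show 2 / (c * E) * (c / 2 * E) = 1 by field_simp, Real.one_rpow]
  have hEt : E ≤ 4 * t ^ 2 * energy S f := by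
    refine hEe.trans (mul_le_mul_of_nonneg_right ?_ hen)
    nlinarith
  set w := (c / 2) ^ (2 / d) * E ^ (2 / d) with hw
  have hw0 : 0 < w := by positivity
  have hEw : E * w ≤ 4 * energy S f := by
    calc E * w ≤ 4 * t ^ 2 * energy S f * w := by gcongr
      _ = 4 * energy S f * (t ^ 2 * w) := by ring
      _ = _ := by rw [ht2, mul_one]
  refine hdec.trans ?_
  have : E * (1 - (c / 2) ^ (2 / d) / (16 * (S.card : ℝ)) * E ^ (2 / d)) =
      E - E * w / (16 * S.card) := by rw [hw]; field_simp
  rw [this]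
  have : E * w / (16 * S.card) ≤ 4 * energy S f / (16 * S.card) := by gcongr
  have e : 4 * energy S f / (16 * (S.card : ℝ)) = energy S f / (4 * S.card) := by
    field_simp; ring
  linarith

theorem iterate_lazyAvg_nonneg {f : Γ → ℝ} (h0 : ∀ x, 0 ≤ f x) (n : ℕ) (x : Γ) :
    0 ≤ (lazyAvg S)^[n] f x := by
  induction n generalizing x with
  | zero => exact h0 x
  | succ n ih => rw [Function.iterate_succ_apply']; exact lazyAvg_nonneg ih x

theorem Summable.iterate_lazyAvg {f : Γ → ℝ} (hf : Summable f) (n : ℕ) :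
    Summable ((_root_.lazyAvg S)^[n] f) := by
  induction n with
  | zero => exact hf
  | succ n ih => rw [Function.iterate_succ_apply']; exact ih.lazyAvg

theorem tsum_iterate_lazyAvg (hS : S.Nonempty) {f : Γ → ℝ} (hf : Summable f) (n : ℕ) :
    ∑' x, (lazyAvg S)^[n] f x = ∑' x, f x := by
  induction n with
  | zero => rfl
  | succ n ih =>
    rw [Function.iterate_succ_apply', tsum_lazyAvg hS (hf.iterate_lazyAvg n), ih]

theorem tsum_iterate_lazyAvg_mul (hsym : ∀ s ∈ S, s⁻¹ ∈ S) {f g : Γ → ℝ}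
    (hf : Summable f) (hf0 : ∀ x, 0 ≤ f x) (hg : Summable g) (hg0 : ∀ x, 0 ≤ g x) (n : ℕ) :
    ∑' x, (lazyAvg S)^[n] f x * g x = ∑' x, f x * (lazyAvg S)^[n] g x := by
  induction n generalizing g with
  | zero => rfl
  | succ n ih =>
    rw [Function.iterate_succ_apply', Function.iterate_succ_apply, ← ih hg.lazyAvg (lazyAvg_nonneg hg0)]
    exact tsum_lazyAvg_mul hsym ((hf.iterate_lazyAvg n).sq_of_nonneg (iterate_lazyAvg_nonneg hf0 n))
      (hg.sq_of_nonneg hg0)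

theorem iterate_lazyAvg_rpow_le (hS : S.Nonempty) {p : ℝ} (hp : 1 ≤ p) (f : Γ → ℝ) (n : ℕ) (x : Γ) :
    |(lazyAvg S)^[n] f x| ^ p ≤ (lazyAvg S)^[n] (fun y => |f y| ^ p) x := by
  induction n generalizing x with
  | zero => exact le_rfl
  | succ n ih =>
    rw [Function.iterate_succ_apply', Function.iterate_succ_apply']
    refine (lazyAvg_rpow_le hS hp _ x).trans (Finset.sum_le_sum fun s _ => ?_)
    gcongr
    · exact ih x
    · exact ih (s * x)

/-- `ℓ¹ → ℓ²` decay of the lazy random walk (Nash's inequality). -/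
theorem exists_tsum_iterate_lazyAvg_sq_le [DecidableEq Γ] (hS : S.Nonempty) {d c : ℝ} (hd : 0 < d)
    (hc : 0 < c) (hgrowth : ∀ n : ℕ, 1 ≤ n → c * (n : ℝ) ^ d ≤ ((cball S n).card : ℝ)) :
    ∃ μ : ℝ, 0 < μ ∧ ∀ f : Γ → ℝ, Summable f → (∀ x, 0 ≤ f x) → ∑' x, f x = 1 → ∀ n : ℕ,
      ∑' x, ((lazyAvg S)^[n] f x) ^ 2 ≤ (μ * ((n : ℝ) + 1)) ^ (-(d / 2)) := by
  have hSc : (0 : ℝ) < S.card := by exact_mod_cast hS.card_pos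
  set c' := min c 1 with hc'
  have hc0 : 0 < c' := lt_min hc one_pos
  have hg' : ∀ n : ℕ, 1 ≤ n → c' * (n : ℝ) ^ d ≤ ((cball S n).card : ℝ) := fun n hn =>
    (mul_le_mul_of_nonneg_right (min_le_left _ _) (by positivity)).trans (hgrowth n hn)
  have hκ : 0 < (c' / 2) ^ (2 / d) / (16 * (S.card : ℝ)) := by positivity
  refine ⟨_, lt_min one_pos (mul_pos hκ (by positivity : 0 < 2 / d)), fun f hf h0 h1 n => ?_⟩
  have hsum := hf.iterate_lazyAvg (S := S)
  have hnn := iterate_lazyAvg_nonneg (S := S) h0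
  have ht := fun n => (tsum_iterate_lazyAvg hS hf n).trans h1
  have hpos : ∀ n, 0 < ∑' x, ((lazyAvg S)^[n] f x) ^ 2 := fun n => by
    have hne : ∃ x, (lazyAvg S)^[n] f x ≠ 0 := by
      by_contra! h
      have := ht n
      simp [h] at this
    obtain ⟨x, hx⟩ := hne
    exact ((hsum n).sq_of_nonneg (hnn n)).tsum_pos (fun _ => sq_nonneg _) x (by positivity)
  have hle : ∀ n, ∑' x, ((lazyAvg S)^[n] f x) ^ 2 ≤ 1 := fun n => by
    rw [← ht n]
    refine ((hsum n).sq_of_nonneg (hnn n)).tsum_le_tsum (fun x => ?_) (hsum n)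
    rw [sq]
    refine mul_le_of_le_one_right (hnn n x) ?_
    rw [← ht n]
    exact (hsum n).le_tsum x fun j _ => hnn n j
  have := le_rpow_of_decay hκ (by positivity : 0 < 2 / d) hpos (hle 0) (fun n => by
    have := tsum_lazyAvg_sq_le_of_growth hS hd hc0 (min_le_right _ _) hg' (hsum n) (hnn n) (ht n)
      (hpos n) (hle n)
    simpa only [Function.iterate_succ_apply'] using this) n
  rwa [one_div_div] at this

/-- `ℓ¹ → ℓ^∞` decay of the lazy random walk under polynomial growth. -/
theorem exists_iterate_lazyAvg_le [DecidableEq Γ] (hsym : ∀ s ∈ S, s⁻¹ ∈ S) (hS : S.Nonempty)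
    {d c : ℝ} (hd : 0 < d) (hc : 0 < c)
    (hgrowth : ∀ n : ℕ, 1 ≤ n → c * (n : ℝ) ^ d ≤ ((cball S n).card : ℝ)) :
    ∃ C : ℝ, 0 < C ∧ ∀ f : Γ → ℝ, Summable f → (∀ x, 0 ≤ f x) → ∀ (k : ℕ) (x : Γ),
      (lazyAvg S)^[k] f x ≤ C * ((k : ℝ) + 1) ^ (-(d / 2)) * ∑' y, f y := by
  obtain ⟨μ, hμ, H⟩ := exists_tsum_iterate_lazyAvg_sq_le hS hd hc hgrowth
  have even : ∀ f : Γ → ℝ, Summable f → (∀ x, 0 ≤ f x) → ∑' x, f x = 1 → ∀ (n : ℕ) (x : Γ),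
      (lazyAvg S)^[n + n] f x ≤ (μ * ((n : ℝ) + 1)) ^ (-(d / 2)) := fun f hf h0 h1 n x => by
    set δ : Γ → ℝ := fun y => if y = x then 1 else 0 with hδ
    have hδ0 : ∀ y, 0 ≤ δ y := fun y => by simp only [hδ]; split_ifs <;> norm_num
    have hδs : Summable δ := summable_of_ne_finset_zero (s := {x}) fun y hy => by
      simp only [Finset.mem_singleton] at hy; simp [hδ, hy]
    have hδ1 : ∑' y, δ y = 1 := tsum_ite_eq x fun _ => (1 : ℝ)
    have e : (lazyAvg S)^[n + n] f x = ∑' y, (lazyAvg S)^[n] f y * (lazyAvg S)^[n] δ y := by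
      rw [← tsum_iterate_lazyAvg_mul hsym (hf.iterate_lazyAvg n) (iterate_lazyAvg_nonneg h0 n) hδs hδ0,
        ← Function.iterate_add_apply]
      simp only [hδ, mul_ite, mul_one, mul_zero]
      exact (tsum_ite_eq x _).symm
    have s1 := (hf.iterate_lazyAvg n).sq_of_nonneg (iterate_lazyAvg_nonneg (S := S) h0 n)
    have s2 := (hδs.iterate_lazyAvg n).sq_of_nonneg (iterate_lazyAvg_nonneg (S := S) hδ0 n)
    have h2 := (s1.mul_of_sq s2).tsum_le_tsum (g := fun y =>
      (((lazyAvg S)^[n] f y) ^ 2 + ((lazyAvg S)^[n] δ y) ^ 2) / 2) (fun y => by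
        nlinarith [sq_nonneg ((lazyAvg S)^[n] f y - (lazyAvg S)^[n] δ y)]) ((s1.add s2).div_const 2)
    rw [tsum_div_const, s1.tsum_add s2] at h2
    rw [e]
    linarith [H f hf h0 h1 n, H δ hδs hδ0 hδ1 n]
  refine ⟨(μ / 2) ^ (-(d / 2)), by positivity, fun f hf h0 k x => ?_⟩
  have unit : ∀ f : Γ → ℝ, Summable f → (∀ x, 0 ≤ f x) → ∑' x, f x = 1 →
      (lazyAvg S)^[k] f x ≤ (μ / 2) ^ (-(d / 2)) * ((k : ℝ) + 1) ^ (-(d / 2)) := fun f hf h0 h1 => by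
    rw [← Real.mul_rpow (by positivity) (by positivity)]
    have mono : ∀ n : ℕ, k ≤ 2 * n + 1 → (μ * ((n : ℝ) + 1)) ^ (-(d / 2)) ≤
        (μ / 2 * ((k : ℝ) + 1)) ^ (-(d / 2)) := fun n hn => by
      refine Real.rpow_le_rpow_of_nonpos (by positivity) ?_ (by linarith)
      have : (k : ℝ) ≤ 2 * n + 1 := by exact_mod_cast hn
      nlinarith
    rcases Nat.even_or_odd' k with ⟨n, hk | hk⟩
    · refine le_trans ?_ (mono n (by omega))
      rw [hk, two_mul]
      exact even f hf h0 h1 n x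
    · refine le_trans ?_ (mono n (by omega))
      rw [hk, two_mul, Function.iterate_succ_apply]
      exact even _ hf.lazyAvg (lazyAvg_nonneg h0) ((tsum_lazyAvg hS hf).trans h1) n x
  have hT0 : 0 ≤ ∑' y, f y := tsum_nonneg h0
  rcases hT0.eq_or_lt with hT | hT
  · have : (lazyAvg S)^[k] f x ≤ ∑' y, (lazyAvg S)^[k] f y :=
      (hf.iterate_lazyAvg k).le_tsum x fun y _ => iterate_lazyAvg_nonneg h0 k y
    rw [tsum_iterate_lazyAvg hS hf k, ← hT] at this
    rwa [← hT, mul_zero]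
  · have hscale : ∀ (a : ℝ) (n : ℕ) (x : Γ),
        (lazyAvg S)^[n] (fun y => f y * a) x = (lazyAvg S)^[n] f x * a := fun a n => by
      induction n with
      | zero => exact fun _ => rfl
      | succ n ih =>
        intro x
        rw [Function.iterate_succ_apply', Function.iterate_succ_apply', lazyAvg, lazyAvg,
          Finset.sum_mul]
        exact Finset.sum_congr rfl fun s _ => by rw [ih, ih]; ring
    have := unit (fun y => f y * (∑' y, f y)⁻¹) (hf.mul_right _)
      (fun y => mul_nonneg (h0 y) (inv_nonneg.mpr hT.le))
      (by rw [tsum_mul_right, mul_inv_cancel₀ hT.ne'])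
    rwa [hscale, ← div_eq_mul_inv, div_le_iff₀ hT] at this

/-- The Green operator of the lazy random walk maps `ℓ^p` into `c₀` when `p < d / 2`. -/
theorem exists_sub_lazyAvg_eq [DecidableEq Γ] (hsym : ∀ s ∈ S, s⁻¹ ∈ S) (hS : S.Nonempty)
    {d c : ℝ} (hc : 0 < c)
    (hgrowth : ∀ n : ℕ, 1 ≤ n → c * (n : ℝ) ^ d ≤ ((cball S n).card : ℝ))
    {p : ℝ} (hp : 1 ≤ p) (hpd : p < d / 2) {f : Γ → ℝ} (hf : lpMem p f) :
    ∃ u : Γ → ℝ, BoundedFun u ∧ Tendsto u cofinite (𝓝 0) ∧ ∀ x, u x - lazyAvg S u x = f x := by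
  have hp0 : 0 < p := by linarith
  obtain ⟨C, hC, H⟩ := exists_iterate_lazyAvg_le hsym hS (by linarith : 0 < d) hc hgrowth
  have hfp0 : ∀ x, 0 ≤ |f x| ^ p := fun x => by positivity
  set T := ∑' y, |f y| ^ p
  have hT : 0 ≤ T := tsum_nonneg hfp0
  set b : ℕ → ℝ := fun k => (C * T) ^ (1 / p) * ((k : ℝ) + 1) ^ (-(d / 2) * (1 / p))
  have hb : Summable b := by
    have h : Summable fun k : ℕ => (k : ℝ) ^ (-(d / 2) * (1 / p)) := by
      rw [Real.summable_nat_rpow, neg_mul, neg_lt_neg_iff, mul_one_div, lt_div_iff₀ hp0]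
      linarith
    have h' := ((summable_nat_add_iff 1).mpr h).mul_left ((C * T) ^ (1 / p))
    simpa only [b, Nat.cast_add, Nat.cast_one] using h'
  have hroot : ∀ t : ℝ, (|t| ^ p) ^ (1 / p) = |t| := fun t => by
    rw [← Real.rpow_mul (abs_nonneg t), mul_one_div_cancel hp0.ne', Real.rpow_one]
  have hbound : ∀ x k, ‖(lazyAvg S)^[k] f x‖ ≤ b k := fun x k => by
    have h := (iterate_lazyAvg_rpow_le hS hp f k x).trans (H _ hf hfp0 k x)
    have h' := Real.rpow_le_rpow (by positivity) h (by positivity : 0 ≤ 1 / p)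
    rw [hroot] at h'
    refine h'.trans (le_of_eq ?_)
    rw [mul_right_comm, Real.mul_rpow (by positivity) (by positivity),
      ← Real.rpow_mul (by positivity)]
  have hsum : ∀ x, Summable fun k => (lazyAvg S)^[k] f x := fun x =>
    Summable.of_norm_bounded hb (hbound x)
  have hzero : ∀ k, Tendsto ((lazyAvg S)^[k] f) cofinite (𝓝 0) := fun k => by
    have h := (Summable.of_nonneg_of_le (fun x => by positivity)
      (iterate_lazyAvg_rpow_le hS hp f k)
      (Summable.iterate_lazyAvg (S := S) hf k)).tendsto_cofinite_zero
    have h' := h.rpow_const (p := 1 / p) (Or.inr (by positivity))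
    simp only [hroot] at h'
    rw [Real.zero_rpow (by positivity)] at h'
    exact (tendsto_zero_iff_abs_tendsto_zero _).mpr h'
  refine ⟨fun x => ∑' k, (lazyAvg S)^[k] f x, ⟨∑' k, b k, fun x => ?_⟩, ?_, fun x => ?_⟩
  · exact tsum_of_norm_bounded hb.hasSum (hbound x)
  · simpa using tendsto_tsum_of_dominated_convergence hb hzero (Eventually.of_forall hbound)
  · have : lazyAvg S (fun x => ∑' k, (lazyAvg S)^[k] f x) x = ∑' k, (lazyAvg S)^[k + 1] f x := by
      simp only [Function.iterate_succ_apply']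
      simp only [lazyAvg]
      rw [Summable.tsum_finsetSum fun s _ => ((hsum x).add (hsum (s * x))).div_const _]
      refine Finset.sum_congr rfl fun s _ => ?_
      rw [tsum_div_const, (hsum x).tsum_add (hsum (s * x))]
    rw [this]
    beta_reduce
    rw [(hsum x).tsum_eq_zero_add]
    simp

end LazyWalk

section Truncation

theorem abs_clamp_sub_clamp_le_s4 (M a b : ℝ) :
    |max (-M) (min a M) - max (-M) (min b M)| ≤ |a - b| := by
  refine (abs_max_sub_max_le_max _ _ _ _).trans ?_
  rw [sub_self, abs_zero, max_eq_right (abs_nonneg _)]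
  refine (abs_min_sub_min_le_max _ _ _ _).trans ?_
  rw [sub_self, abs_zero, max_eq_left (abs_nonneg _)]

theorem abs_clamp_le_s4 {M : ℝ} (hM : 0 ≤ M) (a : ℝ) : |max (-M) (min a M)| ≤ M :=
  abs_le.mpr ⟨le_max_left _ _, max_le (by linarith) (min_le_right _ _)⟩

theorem clamp_eq_self {M a : ℝ} (h : |a| ≤ M) : max (-M) (min a M) = a := by
  rw [min_eq_left (abs_le.mp h).2, max_eq_right (abs_le.mp h).1]

theorem tendsto_clamp_nhds_zero (a : ℝ) :
    Tendsto (fun n : ℕ => max (-(1 / ((n : ℝ) + 1))) (min a (1 / ((n : ℝ) + 1)))) atTop (𝓝 0) :=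
  squeeze_zero_norm (fun n => abs_clamp_le_s4 (by positivity) a) tendsto_one_div_add_atTop_nhds_zero_nat

theorem tendsto_sub_clamp_atTop (a : ℝ) :
    Tendsto (fun n : ℕ => a - max (-(n : ℝ)) (min a n)) atTop (𝓝 0) := by
  refine tendsto_const_nhds.congr' ?_
  filter_upwards [eventually_ge_atTop ⌈|a|⌉₊] with n hn
  rw [clamp_eq_self (Nat.ceil_le.mp hn), sub_self]

variable {X : Type*} (G : LFGraph X)

theorem LFGraph.MemDp.mono {p C : ℝ} (hp : 0 ≤ p) (hC : 0 ≤ C) {g h : X → ℝ} (hg : G.MemDp p g)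
    (hle : ∀ x y, |h y - h x| ≤ C * |g y - g x|) : G.MemDp p h := by
  refine Summable.of_nonneg_of_le (fun e => by positivity) (fun e => ?_) (hg.mul_left (C ^ p))
  rw [← Real.mul_rpow hC (abs_nonneg _)]
  exact Real.rpow_le_rpow (abs_nonneg _) (hle _ _) hp

/-- If every truncation of `g ∈ D^p` tends to a constant at infinity, then `g` lies in the
`D^p`-closure of `ℓ^p + ℝ·1`. -/
theorem LFGraph.inClos_of_clamp {p : ℝ} (hp : 0 < p) (e0 : X) {g : X → ℝ} (hg : G.MemDp p g)
    (hlim : ∀ n : ℕ, ∃ c : ℝ, Tendsto (fun x => max (-(n : ℝ)) (min (g x) n)) cofinite (𝓝 c)) :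
    G.InClos p e0 g := by
  choose c hc using hlim
  set u : ℕ → X → ℝ := fun n x => max (-(n : ℝ)) (min (g x) n) - c n with hu
  set v : ℕ → X → ℝ := fun n x => max (-(1 / ((n : ℝ) + 1))) (min (u n x) (1 / ((n : ℝ) + 1))) with hv
  set h : ℕ → X → ℝ := fun n x => g x - ((u n x - v n x) + c n) with hh
  have hh' : ∀ n x, h n x = (g x - max (-(n : ℝ)) (min (g x) n)) + v n x := fun n x => by
    simp only [hh, hu]; ring
  have hule : ∀ n x y, |u n y - u n x| ≤ |g y - g x| := fun n x y => by
    simp only [hu, sub_sub_sub_cancel_right]; exact abs_clamp_sub_clamp_le_s4 _ _ _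
  have hle : ∀ n x y, |h n y - h n x| ≤ 3 * |g y - g x| := fun n x y => by
    have h1 : |v n y - v n x| ≤ |g y - g x| := (abs_clamp_sub_clamp_le_s4 _ _ _).trans (hule n x y)
    have h2 := abs_clamp_sub_clamp_le_s4 n (g y) (g x)
    rw [hh', hh']
    rw [abs_le] at *
    constructor <;> linarith [neg_abs_le (g y - g x), le_abs_self (g y - g x)]
  have hv0 : ∀ x y, Tendsto (fun n => v n y - v n x) atTop (𝓝 0) := fun x y => by
    refine squeeze_zero_norm (a := fun n : ℕ => 2 * (1 / ((n : ℝ) + 1))) (fun n => ?_) ?_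
    · have h1 := abs_clamp_le_s4 (by positivity : 0 ≤ 1 / ((n : ℝ) + 1)) (u n y)
      have h2 := abs_clamp_le_s4 (by positivity : 0 ≤ 1 / ((n : ℝ) + 1)) (u n x)
      exact (abs_sub _ _).trans (by linarith)
    · simpa using (tendsto_one_div_add_atTop_nhds_zero_nat (𝕜 := ℝ)).const_mul 2
  have hgrad : ∀ e : G.Edge, Tendsto (fun n => |G.grad (h n) e| ^ p) atTop (𝓝 0) := fun e => by
    have h1 := (((tendsto_sub_clamp_atTop (g e.1.2)).sub (tendsto_sub_clamp_atTop (g e.1.1))).add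
      (hv0 e.1.1 e.1.2)).abs.rpow_const (p := p) (Or.inr hp.le)
    simp only [sub_zero, add_zero, abs_zero, Real.zero_rpow hp.ne'] at h1
    refine h1.congr fun n => ?_
    simp only [LFGraph.grad, hh']
    congr 2
    ring
  have hsum : Tendsto (fun n => ∑' e : G.Edge, |G.grad (h n) e| ^ p) atTop (𝓝 0) := by
    have := tendsto_tsum_of_dominated_convergence (hg.mul_left (3 ^ p)) hgrad
      (Eventually.of_forall fun n e => by
        rw [Real.norm_of_nonneg (by positivity), ← Real.mul_rpow (by norm_num) (abs_nonneg _)]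
        exact Real.rpow_le_rpow (abs_nonneg _) (hle n _ _) hp.le)
    simpa using this
  have hval : Tendsto (fun n => |h n e0|) atTop (𝓝 0) := by
    have h1 : Tendsto (fun n => v n e0) atTop (𝓝 0) :=
      squeeze_zero_norm (fun n => abs_clamp_le_s4 (by positivity) _)
        tendsto_one_div_add_atTop_nhds_zero_nat
    simpa [hh'] using ((tendsto_sub_clamp_atTop (g e0)).add h1).abs
  have hdist : Tendsto (fun n => G.dpDist p e0 g fun x => (u n x - v n x) + c n) atTop (𝓝 0) := by
    have h1 := hsum.rpow_const (p := 1 / p) (Or.inr (by positivity))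
    rw [Real.zero_rpow (by positivity)] at h1
    have h2 := h1.add hval
    rw [add_zero] at h2
    exact h2
  intro ε hε
  obtain ⟨n, hn⟩ := (hdist.eventually_lt_const hε).exists
  refine ⟨fun x => u n x - v n x, c n, ?_, hg.mono G hp.le (by norm_num) (hle n), hn⟩
  have hu0 : Tendsto (u n) cofinite (𝓝 0) := by simpa [hu] using (hc n).sub_const (c n)
  have hfin : ∀ᶠ x in cofinite, |u n x| < 1 / ((n : ℝ) + 1) := by
    have := hu0.abs
    rw [abs_zero] at this
    exact this.eventually_lt_const (by positivity)
  refine summable_of_hasFiniteSupport (Set.Finite.subset hfin fun x hx hlt => hx ?_)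
  simp only [hv, clamp_eq_self hlt.le, sub_self, abs_zero, Real.zero_rpow hp.ne']

end Truncation

section Cayley

variable {Γ : Type*} [Group Γ] [DecidableEq Γ] {S : Finset Γ} {hsym : ∀ s ∈ S, s⁻¹ ∈ S}
  {h1 : (1 : Γ) ∉ S}

theorem sum_nbr_cayley (f : Γ → ℝ) (x : Γ) :
    ∑ y ∈ (cayley S hsym h1).nbr x, f y = ∑ s ∈ S, f (s * x) :=
  Finset.sum_image fun _ _ _ _ h => mul_right_cancel h

theorem card_nbr_cayley (x : Γ) : ((cayley S hsym h1).nbr x).card = S.card :=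
  Finset.card_image_of_injective _ (mul_left_injective x)

theorem harmonic_cayley_of_lazyAvg (hS : S.Nonempty) {h : Γ → ℝ} (hh : ∀ x, lazyAvg S h x = h x) :
    (cayley S hsym h1).Harmonic h := fun x => by
  have hc : (0 : ℝ) < S.card := by exact_mod_cast hS.card_pos
  have := lazyAvg_sub_self hS h x
  rw [hh, sub_self, ← Finset.sum_div, Finset.sum_sub_distrib, Finset.sum_const, nsmul_eq_mul,
    eq_comm, div_eq_zero_iff] at this
  rw [sum_nbr_cayley, card_nbr_cayley]
  rcases this with h | h
  · linarith
  · linarith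

theorem summable_translate_sub_of_memDp {p : ℝ} {g : Γ → ℝ}
    (hg : (cayley S hsym h1).MemDp p g) {s : Γ} (hs : s ∈ S) :
    Summable fun x => |g (s * x) - g x| ^ p := by
  have hmem : ∀ x, s * x ∈ (cayley S hsym h1).nbr x := fun x =>
    Finset.mem_image.mpr ⟨s, hs, rfl⟩
  have hi : Function.Injective fun x => (⟨(x, s * x), hmem x⟩ : (cayley S hsym h1).Edge) := by
    intro x y hxy
    simp only [Subtype.mk.injEq, Prod.mk.injEq] at hxy
    exact hxy.1
  have h := Summable.comp_injective (f := fun e => |(cayley S hsym h1).grad g e| ^ p) hg hi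
  simpa only [Function.comp_def, LFGraph.grad] using h

theorem lpMem_sub_lazyAvg (hS : S.Nonempty) {p : ℝ} (hp : 1 ≤ p) {g : Γ → ℝ}
    (hg : (cayley S hsym h1).MemDp p g) : lpMem p fun x => g x - lazyAvg S g x := by
  have hc : (0 : ℝ) < S.card := by exact_mod_cast hS.card_pos
  have hs := fun s (h : s ∈ S) => summable_translate_sub_of_memDp hg h
  have hle : ∀ x, |g x - lazyAvg S g x| ^ p ≤
      ∑ s ∈ S, 1 / (S.card : ℝ) * |g (s * x) - g x| ^ p := fun x => by
    have hmean : |g x - lazyAvg S g x| ≤ ∑ s ∈ S, 1 / (S.card : ℝ) * |g (s * x) - g x| := by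
      rw [lazyAvg_sub_self hS]
      refine (Finset.abs_sum_le_sum_abs _ _).trans (Finset.sum_le_sum fun s _ => ?_)
      rw [abs_div, abs_of_pos (by positivity : (0 : ℝ) < 2 * S.card), abs_sub_comm,
        div_le_iff₀ (by positivity)]
      field_simp
      linarith [abs_nonneg (g (s * x) - g x)]
    refine (Real.rpow_le_rpow (abs_nonneg _) hmean (by linarith)).trans ?_
    refine Real.rpow_arith_mean_le_arith_mean_rpow S (fun _ => 1 / (S.card : ℝ))
      (fun s => |g (s * x) - g x|) (fun _ _ => by positivity) ?_ (fun _ _ => abs_nonneg _) hp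
    rw [Finset.sum_const, nsmul_eq_mul]
    field_simp
  exact Summable.of_nonneg_of_le (fun x => Real.rpow_nonneg (abs_nonneg _) p) hle
    (summable_sum fun s h => (hs s h).mul_left (1 / (S.card : ℝ)))

theorem exists_tendsto_cofinite_of_bounded (hS : S.Nonempty) {d c : ℝ} (hc : 0 < c)
    (hgrowth : ∀ n : ℕ, 1 ≤ n → c * (n : ℝ) ^ d ≤ ((cball S n).card : ℝ))
    (hLiou : (cayley S hsym h1).Liouville) {p : ℝ} (hp : 1 ≤ p) (hpd : p < d / 2)
    {g : Γ → ℝ} (hg : (cayley S hsym h1).MemDp p g) (hbdd : BoundedFun g) :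
    ∃ a : ℝ, Tendsto g cofinite (𝓝 a) := by
  obtain ⟨u, ⟨M, hM⟩, hu0, hu⟩ :=
    exists_sub_lazyAvg_eq hsym hS hc hgrowth hp hpd (lpMem_sub_lazyAvg hS hp hg)
  obtain ⟨N, hN⟩ := hbdd
  have hconst := hLiou (fun x => g x - u x) (harmonic_cayley_of_lazyAvg hS fun x => by
      have : lazyAvg S (fun x => g x - u x) x = lazyAvg S g x - lazyAvg S u x := by
        simp only [lazyAvg]
        rw [← Finset.sum_sub_distrib]
        exact Finset.sum_congr rfl fun s _ => by ring
      rw [this]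
      linarith [hu x])
    ⟨N + M, fun x => (abs_sub _ _).trans (add_le_add (hN x) (hM x))⟩
  refine ⟨g 1 - u 1, ?_⟩
  have := hu0.add_const (g 1 - u 1)
  rw [zero_add] at this
  refine this.congr fun x => ?_
  have := hconst x 1
  linarith

theorem cball_empty (n : ℕ) : cball (∅ : Finset Γ) n = {1} := by
  induction n with
  | zero => rfl
  | succ n ih => simp [cball, ih]

theorem nonempty_of_growth {d c : ℝ} (hd : 0 < d) (hc : 0 < c)
    (hgrowth : ∀ n : ℕ, 1 ≤ n → c * (n : ℝ) ^ d ≤ ((cball S n).card : ℝ)) : S.Nonempty := by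
  rw [Finset.nonempty_iff_ne_empty]
  rintro rfl
  have hlim := ((tendsto_rpow_atTop hd).comp tendsto_natCast_atTop_atTop).const_mul_atTop hc
  obtain ⟨n, hn1, hn⟩ := ((eventually_ge_atTop 1).and (hlim.eventually_gt_atTop 1)).exists
  have := hgrowth n hn1
  rw [cball_empty] at this
  simp only [Finset.card_singleton, Nat.cast_one, Function.comp_apply] at this hn
  linarith

end Cayley

/-- A finitely generated group of growth at least polynomial of degree
`d` whose Cayley graph is Liouville has trivial reduced `ℓ^p`-cohomology in degree
one, for every `1 ≤ p < d/2`. -/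
theorem stmt4 {Γ : Type*} [Group Γ] [DecidableEq Γ]
    (S : Finset Γ) (hsym : ∀ s ∈ S, s⁻¹ ∈ S) (h1 : (1 : Γ) ∉ S)
    (hgen : Subgroup.closure (S : Set Γ) = ⊤)
    (d c : ℝ) (hc : 0 < c)
    (hgrowth : ∀ n : ℕ, 1 ≤ n → c * (n : ℝ) ^ d ≤ ((cball S n).card : ℝ))
    (hLiou : (cayley S hsym h1).Liouville)
    (p : ℝ) (hp : 1 ≤ p) (hpd : p < d / 2) (e0 : Γ)
    (g : Γ → ℝ) (hg : (cayley S hsym h1).MemDp p g) :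
    (cayley S hsym h1).InClos p e0 g := by
  have hS := nonempty_of_growth (by linarith) hc hgrowth
  refine LFGraph.inClos_of_clamp _ (by linarith) e0 hg fun n => ?_
  refine exists_tendsto_cofinite_of_bounded hS hc hgrowth hLiou hp hpd
    (hg.mono _ (by linarith) zero_le_one fun x y => ?_) ⟨n, fun x => abs_clamp_le_s4 n.cast_nonneg _⟩
  rw [one_mul]
  exact abs_clamp_sub_clamp_le_s4 _ _ _
end
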